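/- arXiv:0912.5467 — 7 statements merged into one kernel-verified Lean document; each statement's English description precedes it below -/
import Mathlib

section
/- Let A_1,…,A_s be real l×m matrices and let c ∈ ℝ^m be nonzero with c in the range of Σ_{i=1}^s A_i^T A_i. Then the supremum of c^T u over {u ∈ ℝ^m : ‖A_i u‖ ≤ 1 for all i ∈ {1,…,s}} is attained by some u*, the infimum of Σ_{i=1}^s μ_i over {(μ, h_1,…,h_s) : μ ∈ ℝ^s, h_i ∈ ℝ^l, c = Σ_{i=1}^s A_i^T h_i, and ‖h_i‖ ≤ μ_i for all i} is attained by some (μ*, h*), and the two optimal values coincide: c^T u* = Σ_i μ_i*. Moreover, setting t := (Σ_i μ_i*)^{−1} and w := t·μ*, the vector w is a c-optimal design, and the minimal variance is V_c(w) = t^{−2} = (Σ_i μ_i*)² = (c^T u*)². -/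
open Matrix BigOperators

/-- Euclidean norm on `Fin n → ℝ`. -/
noncomputable def euclNorm {n : ℕ} (v : Fin n → ℝ) : ℝ :=
  Real.sqrt (∑ i, v i ^ 2)

/-- Information matrix `M(w) = ∑ i, w i • A iᵀ A i` for multiresponse experiments. -/
noncomputable def infoMat {s l m : ℕ} (A : Fin s → Matrix (Fin l) (Fin m) ℝ)
    (w : Fin s → ℝ) : Matrix (Fin m) (Fin m) ℝ :=
  ∑ i, w i • ((A i)ᵀ * A i)

/-- A design: nonnegative weights summing to one. -/
def IsDesign {s : ℕ} (w : Fin s → ℝ) : Prop :=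
  (∀ i, 0 ≤ w i) ∧ ∑ i, w i = 1

/-- `w` is feasible for `c` when `c` lies in the range of `M(w)`. -/
def FeasibleFor {s l m : ℕ} (A : Fin s → Matrix (Fin l) (Fin m) ℝ) (c : Fin m → ℝ)
    (w : Fin s → ℝ) : Prop :=
  ∃ u, infoMat A w *ᵥ u = c

/-- `w` is a `c`-optimal design. -/
def IsCOptimal {s l m : ℕ} (A : Fin s → Matrix (Fin l) (Fin m) ℝ) (c : Fin m → ℝ)
    (w : Fin s → ℝ) : Prop :=
  IsDesign w ∧ FeasibleFor A c w ∧
    ∀ (w' : Fin s → ℝ) (u u' : Fin m → ℝ), IsDesign w' →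
      infoMat A w *ᵥ u = c → infoMat A w' *ᵥ u' = c →
        c ⬝ᵥ u ≤ c ⬝ᵥ u'

/-- Feasibility for the primal SOCP: `‖A i u‖ ≤ 1` for all `i`. -/
def PrimalSOCPFeas {s l m : ℕ} (A : Fin s → Matrix (Fin l) (Fin m) ℝ)
    (u : Fin m → ℝ) : Prop :=
  ∀ i, euclNorm (A i *ᵥ u) ≤ 1

/-- Feasibility for the dual SOCP: `c = ∑ i, A iᵀ h i` and `‖h i‖ ≤ μ i`. -/
def DualSOCPFeas {s l m : ℕ} (A : Fin s → Matrix (Fin l) (Fin m) ℝ) (c : Fin m → ℝ)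
    (μ : Fin s → ℝ) (h : Fin s → Fin l → ℝ) : Prop :=
  (∑ i, (A i)ᵀ *ᵥ h i = c) ∧ ∀ i, euclNorm (h i) ≤ μ i

open scoped RealInnerProductSpace in
/-- The norm of a functional on a finite product (with the sup norm) dominates the sum of the norms
of the vectors representing it. -/
lemma sum_norm_le_opNorm_of_eq_sum_inner {ι F : Type*} [Fintype ι] [NormedAddCommGroup F]
    [InnerProductSpace ℝ F] (g : (ι → F) →L[ℝ] ℝ) (h : ι → F)
    (hg : ∀ x, g x = ∑ i, ⟪h i, x i⟫) : ∑ i, ‖h i‖ ≤ ‖g‖ := by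
  have hx : ‖fun i => ‖h i‖⁻¹ • h i‖ ≤ 1 := by
    refine (pi_norm_le_iff_of_nonneg zero_le_one).2 fun i => ?_
    rw [norm_smul, norm_inv, norm_norm]
    exact inv_mul_le_one
  have hgx : g (fun i => ‖h i‖⁻¹ • h i) = ∑ i, ‖h i‖ := by
    rw [hg]
    refine Finset.sum_congr rfl fun i _ => ?_
    rw [real_inner_smul_right, real_inner_self_eq_norm_sq]
    rcases eq_or_ne ‖h i‖ 0 with h0 | h0
    · simp [h0]
    · field_simp
  rw [← hgx]
  exact (le_abs_self _).trans (g.unit_le_opNorm _ hx)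

open scoped RealInnerProductSpace in
/-- Every functional on a finite product of Hilbert spaces is represented by a family of vectors. -/
lemma exists_eq_sum_inner {ι F : Type*} [Fintype ι] [NormedAddCommGroup F]
    [InnerProductSpace ℝ F] [CompleteSpace F] (g : (ι → F) →L[ℝ] ℝ) :
    ∃ h : ι → F, ∀ x, g x = ∑ i, ⟪h i, x i⟫ := by
  classical
  refine ⟨fun i => (InnerProductSpace.toDual ℝ F).symm
    (g.comp (ContinuousLinearMap.single ℝ (fun _ : ι => F) i)), fun x => ?_⟩
  simp only [InnerProductSpace.toDual_symm_apply, ContinuousLinearMap.comp_apply,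
    ContinuousLinearMap.single_apply]
  rw [← map_sum, Finset.univ_sum_single]

/-- A functional on a finite-dimensional space attains its norm on the closed unit ball. -/
lemma exists_opNorm_le_apply {E : Type*} [NormedAddCommGroup E] [NormedSpace ℝ E]
    [FiniteDimensional ℝ E] (f : E →L[ℝ] ℝ) : ∃ x, ‖x‖ ≤ 1 ∧ ‖f‖ ≤ f x := by
  have : ProperSpace E := FiniteDimensional.proper ℝ E
  obtain ⟨x, hx, hmax⟩ := (isCompact_closedBall (0 : E) 1).exists_isMaxOn
    ⟨0, by simp⟩ f.continuous.continuousOn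
  have hle : ∀ y : E, ‖y‖ ≤ 1 → f y ≤ f x := fun y hy => hmax (by simpa using hy)
  refine ⟨x, by simpa using hx, f.opNorm_le_of_unit_norm ?_ fun y hy => ?_⟩
  · simpa using hle 0 (by simp)
  · exact abs_le'.2 ⟨hle y hy.le, by simpa using hle (-y) (by simp [hy])⟩

open scoped RealInnerProductSpace in
/-- Strong duality between maximizing a functional under `‖T v i‖ ≤ 1` and minimizing `∑ ‖h i‖` over
its representations `v ↦ ∑ ⟪h i, T v i⟫`. -/
lemma exists_strong_duality {ι V F : Type*} [Fintype ι] [AddCommGroup V] [Module ℝ V]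
    [NormedAddCommGroup F] [InnerProductSpace ℝ F] [FiniteDimensional ℝ F]
    (T : V →ₗ[ℝ] ι → F) (y : ι → F) :
    ∃ (v : V) (h : ι → F), (∀ i, ‖T v i‖ ≤ 1) ∧
      (∀ v', ∑ i, ⟪h i, T v' i⟫ = ∑ i, ⟪y i, T v' i⟫) ∧
      ∑ i, ‖h i‖ ≤ ∑ i, ⟪h i, T v i⟫ := by
  have : CompleteSpace F := FiniteDimensional.complete ℝ F
  let G : (ι → F) →L[ℝ] ℝ := ∑ i, (innerSL ℝ (y i)).comp (ContinuousLinearMap.proj i)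
  have hG : ∀ x, G x = ∑ i, ⟪y i, x i⟫ := fun x => by
    simp [G]
  let f := G.comp (LinearMap.range T).subtypeL
  obtain ⟨⟨_, v, rfl⟩, hv1, hfv⟩ := exists_opNorm_le_apply f
  obtain ⟨g, hgf, hgn⟩ := exists_extension_norm_eq _ f
  obtain ⟨h, hh⟩ := exists_eq_sum_inner g
  have hgT : ∀ v', g (T v') = G (T v') := fun v' => hgf ⟨T v', v', rfl⟩
  refine ⟨v, h, (pi_norm_le_iff_of_nonneg zero_le_one).1 hv1, fun v' => ?_, ?_⟩
  · rw [← hh, hgT, hG]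
  · rw [← hh, hgT]
    exact (sum_norm_le_opNorm_of_eq_sum_inner g h hh).trans (hgn.trans_le hfv)

lemma euclNorm_eq_norm {n : ℕ} (v : Fin n → ℝ) : euclNorm v = ‖WithLp.toLp 2 v‖ := by
  simp [euclNorm, EuclideanSpace.norm_eq]

lemma euclNorm_nonneg {n : ℕ} (v : Fin n → ℝ) : 0 ≤ euclNorm v :=
  Real.sqrt_nonneg _

lemma euclNorm_sq {n : ℕ} (v : Fin n → ℝ) : euclNorm v ^ 2 = v ⬝ᵥ v := by
  rw [euclNorm, Real.sq_sqrt (Finset.sum_nonneg fun i _ => sq_nonneg _)]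
  simp [dotProduct, sq]

lemma dotProduct_le_euclNorm_mul {n : ℕ} (v w : Fin n → ℝ) :
    v ⬝ᵥ w ≤ euclNorm v * euclNorm w := by
  simpa [euclNorm, dotProduct] using
    Real.sum_mul_le_sqrt_mul_sqrt Finset.univ v w

lemma sum_transpose_mulVec_dotProduct {s l m : ℕ} (A : Fin s → Matrix (Fin l) (Fin m) ℝ)
    (h : Fin s → Fin l → ℝ) (u : Fin m → ℝ) :
    (∑ i, (A i)ᵀ *ᵥ h i) ⬝ᵥ u = ∑ i, h i ⬝ᵥ A i *ᵥ u := by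
  rw [sum_dotProduct]
  simp [mulVec_transpose, dotProduct_mulVec]

lemma infoMat_mulVec {s l m : ℕ} (A : Fin s → Matrix (Fin l) (Fin m) ℝ) (w : Fin s → ℝ)
    (u : Fin m → ℝ) : infoMat A w *ᵥ u = ∑ i, (A i)ᵀ *ᵥ (w i • A i *ᵥ u) := by
  simp [infoMat, sum_mulVec, smul_mulVec, mulVec_smul]

lemma infoMat_mulVec_dotProduct {s l m : ℕ} (A : Fin s → Matrix (Fin l) (Fin m) ℝ)
    (w : Fin s → ℝ) (u v : Fin m → ℝ) :
    (infoMat A w *ᵥ u) ⬝ᵥ v = ∑ i, w i * (A i *ᵥ u ⬝ᵥ A i *ᵥ v) := by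
  rw [infoMat_mulVec, sum_transpose_mulVec_dotProduct]
  simp

/-- Weak duality for the pair of second-order cone programs. -/
lemma dotProduct_le_sum_of_feas {s l m : ℕ} {A : Fin s → Matrix (Fin l) (Fin m) ℝ}
    {c u : Fin m → ℝ} {μ : Fin s → ℝ} {h : Fin s → Fin l → ℝ} (hu : PrimalSOCPFeas A u)
    (hμ : DualSOCPFeas A c μ h) : c ⬝ᵥ u ≤ ∑ i, μ i := by
  rw [← hμ.1, sum_transpose_mulVec_dotProduct]
  refine Finset.sum_le_sum fun i _ => (dotProduct_le_euclNorm_mul _ _).trans ?_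
  exact (mul_le_of_le_one_right (euclNorm_nonneg _) (hu i)).trans (hμ.2 i)

/-- Every feasible design has variance at least `(cᵀ u)²`, for `u` primal feasible. -/
lemma sq_dotProduct_le_variance {s l m : ℕ} {A : Fin s → Matrix (Fin l) (Fin m) ℝ}
    {c u u' : Fin m → ℝ} {w : Fin s → ℝ} (hu : PrimalSOCPFeas A u) (hw : IsDesign w)
    (hu' : infoMat A w *ᵥ u' = c) : (c ⬝ᵥ u) ^ 2 ≤ c ⬝ᵥ u' := by
  set N := c ⬝ᵥ u with hN
  have hcu : N = ∑ i, w i * (A i *ᵥ u' ⬝ᵥ A i *ᵥ u) := by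
    rw [hN, ← hu', infoMat_mulVec_dotProduct]
  have hcu' : c ⬝ᵥ u' = ∑ i, w i * (A i *ᵥ u' ⬝ᵥ A i *ᵥ u') := by
    rw [← infoMat_mulVec_dotProduct, hu']
  have hterm : ∀ i, w i * (2 * N * (A i *ᵥ u' ⬝ᵥ A i *ᵥ u)) ≤
      w i * (A i *ᵥ u' ⬝ᵥ A i *ᵥ u' + N ^ 2) := fun i => by
    refine mul_le_mul_of_nonneg_left ?_ (hw.1 i)
    have h1 : A i *ᵥ u ⬝ᵥ A i *ᵥ u ≤ 1 := by
      rw [← euclNorm_sq]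
      exact pow_le_one₀ (euclNorm_nonneg _) (hu i)
    have h2 := euclNorm_sq (A i *ᵥ u' - N • A i *ᵥ u)
    simp only [sub_dotProduct, dotProduct_sub, smul_dotProduct, dotProduct_smul, smul_eq_mul,
      dotProduct_comm (A i *ᵥ u) (A i *ᵥ u')] at h2
    nlinarith [sq_nonneg (euclNorm (A i *ᵥ u' - N • A i *ᵥ u)), sq_nonneg N]
  have hsum := Finset.sum_le_sum fun i (_ : i ∈ Finset.univ) => hterm i
  have hl : ∑ i, w i * (2 * N * (A i *ᵥ u' ⬝ᵥ A i *ᵥ u)) = 2 * N * N := by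
    calc _ = ∑ i, 2 * N * (w i * (A i *ᵥ u' ⬝ᵥ A i *ᵥ u)) :=
          Finset.sum_congr rfl fun i _ => by ring
      _ = _ := by rw [← Finset.mul_sum, ← hcu]
  simp only [mul_add, Finset.sum_add_distrib, ← Finset.sum_mul, hw.2] at hsum
  rw [hl, ← hcu'] at hsum
  linarith

/-- Complementary slackness: at a pair without duality gap, `h i = μ i • A i u`. -/
lemma eq_smul_mulVec_of_feas {s l m : ℕ} {A : Fin s → Matrix (Fin l) (Fin m) ℝ}
    {c u : Fin m → ℝ} {μ : Fin s → ℝ} {h : Fin s → Fin l → ℝ} (hu : PrimalSOCPFeas A u)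
    (hμ : DualSOCPFeas A c μ h) (hgap : c ⬝ᵥ u = ∑ i, μ i) (i : Fin s) :
    h i = μ i • A i *ᵥ u := by
  have hle : ∀ j ∈ Finset.univ, h j ⬝ᵥ A j *ᵥ u ≤ μ j := fun j _ =>
    (dotProduct_le_euclNorm_mul _ _).trans <|
      (mul_le_of_le_one_right (euclNorm_nonneg _) (hu j)).trans (hμ.2 j)
  rw [← hμ.1, sum_transpose_mulVec_dotProduct] at hgap
  have heq := (Finset.sum_eq_sum_iff_of_le hle).1 hgap i (Finset.mem_univ i)
  have h1 : A i *ᵥ u ⬝ᵥ A i *ᵥ u ≤ 1 := by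
    rw [← euclNorm_sq]
    exact pow_le_one₀ (euclNorm_nonneg _) (hu i)
  have h2 : h i ⬝ᵥ h i ≤ μ i ^ 2 := by
    rw [← euclNorm_sq]
    exact pow_le_pow_left₀ (euclNorm_nonneg _) (hμ.2 i) 2
  have h3 := euclNorm_sq (h i - μ i • A i *ᵥ u)
  have h4 : (h i - μ i • A i *ᵥ u) ⬝ᵥ (h i - μ i • A i *ᵥ u) = 0 := by
    refine le_antisymm ?_ (h3 ▸ sq_nonneg _)
    simp only [sub_dotProduct, dotProduct_sub, smul_dotProduct, dotProduct_smul, smul_eq_mul,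
      dotProduct_comm (A i *ᵥ u) (h i), heq]
    nlinarith [sq_nonneg (μ i)]
  exact sub_eq_zero.1 (dotProduct_self_eq_zero.1 h4)

/-- Both second-order cone programs are attained by a pair without duality gap. -/
lemma exists_socp_pair {s l m : ℕ} (A : Fin s → Matrix (Fin l) (Fin m) ℝ) (c : Fin m → ℝ)
    (hrange : ∃ u, (∑ i, (A i)ᵀ * A i) *ᵥ u = c) :
    ∃ (u : Fin m → ℝ) (μ : Fin s → ℝ) (h : Fin s → Fin l → ℝ),
      PrimalSOCPFeas A u ∧ DualSOCPFeas A c μ h ∧ c ⬝ᵥ u = ∑ i, μ i := by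
  obtain ⟨u₀, hu₀⟩ := hrange
  have hc : c = ∑ i, (A i)ᵀ *ᵥ (A i *ᵥ u₀) := by
    simp [← hu₀, sum_mulVec]
  let T : (Fin m → ℝ) →ₗ[ℝ] Fin s → EuclideanSpace ℝ (Fin l) :=
    LinearMap.pi fun i => (WithLp.linearEquiv 2 ℝ (Fin l → ℝ)).symm.toLinearMap ∘ₗ (A i).mulVecLin
  have hT : ∀ v i, T v i = WithLp.toLp 2 (A i *ᵥ v) := fun _ _ => rfl
  obtain ⟨u, h, hu, hrep, hle⟩ := exists_strong_duality T (T u₀)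
  have hinner : ∀ (x : EuclideanSpace ℝ (Fin l)) v i,
      inner ℝ x (T v i) = x.ofLp ⬝ᵥ A i *ᵥ v := fun x v i => by
    rw [hT, EuclideanSpace.inner_eq_star_dotProduct, dotProduct_comm]
    simp
  simp only [hinner] at hrep hle
  have hfeas : PrimalSOCPFeas A u := fun i => by
    rw [euclNorm_eq_norm]
    exact hu i
  have hdual : DualSOCPFeas A c (fun i => ‖h i‖) fun i => (h i).ofLp := by
    refine ⟨dotProduct_eq _ _ fun v => ?_, fun i => ?_⟩
    · rw [sum_transpose_mulVec_dotProduct, hrep, hc, sum_transpose_mulVec_dotProduct]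
      rfl
    · rw [euclNorm_eq_norm]
  refine ⟨u, _, _, hfeas, hdual, le_antisymm (dotProduct_le_sum_of_feas hfeas hdual) ?_⟩
  rwa [← hdual.1, sum_transpose_mulVec_dotProduct]

/-- **Computation of the `c`-optimal design by SOCP.** Both the primal and dual
second-order cone programs are attained, their values coincide, and the normalized
dual solution `w := (∑ μ*)⁻¹ • μ*` is a `c-`optimal design with minimal variance
`t⁻² = (∑ μ*)² = (cᵀu*)²`. -/
theorem cOptimal_SOCP {s l m : ℕ} (A : Fin s → Matrix (Fin l) (Fin m) ℝ)
    (c : Fin m → ℝ) (hc : c ≠ 0)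
    (hrange : ∃ u, (∑ i, (A i)ᵀ * A i) *ᵥ u = c) :
    ∃ (ustar : Fin m → ℝ) (μstar : Fin s → ℝ) (hstar : Fin s → Fin l → ℝ),
      PrimalSOCPFeas A ustar ∧ DualSOCPFeas A c μstar hstar ∧
      (∀ u, PrimalSOCPFeas A u → c ⬝ᵥ u ≤ c ⬝ᵥ ustar) ∧
      (∀ μ h, DualSOCPFeas A c μ h → ∑ i, μstar i ≤ ∑ i, μ i) ∧
      c ⬝ᵥ ustar = ∑ i, μstar i ∧
      IsCOptimal A c ((∑ i, μstar i)⁻¹ • μstar) ∧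
      (∀ u, infoMat A ((∑ i, μstar i)⁻¹ • μstar) *ᵥ u = c →
        c ⬝ᵥ u = (∑ i, μstar i) ^ 2 ∧ c ⬝ᵥ u = (c ⬝ᵥ ustar) ^ 2 ∧
          c ⬝ᵥ u = (((∑ i, μstar i)⁻¹) ^ 2)⁻¹) := by
  obtain ⟨u, μ, h, hu, hμ, hgap⟩ := exists_socp_pair A c hrange
  have hμ0 : ∀ i, 0 ≤ μ i := fun i => (euclNorm_nonneg _).trans (hμ.2 i)
  have hslack := eq_smul_mulVec_of_feas hu hμ hgap
  have hN : ∑ i, μ i ≠ 0 := fun h0 => hc <| by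
    have hz := (Finset.sum_eq_zero_iff_of_nonneg fun i _ => hμ0 i).1 h0
    rw [← hμ.1]
    exact Finset.sum_eq_zero fun i hi => by rw [hslack i, hz i hi, zero_smul, mulVec_zero]
  set N := ∑ i, μ i with hNdef
  have hsol : infoMat A (N⁻¹ • μ) *ᵥ (N • u) = c := by
    rw [infoMat_mulVec, ← hμ.1]
    refine Finset.sum_congr rfl fun i _ => ?_
    rw [hslack i, mulVec_smul (A i), smul_smul, Pi.smul_apply, smul_eq_mul]
    congr 2
    field_simp
  have hvar : ∀ v, infoMat A (N⁻¹ • μ) *ᵥ v = c → c ⬝ᵥ v = N ^ 2 := fun v hv => by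
    have hsymm : c ⬝ᵥ v = c ⬝ᵥ (N • u) := by
      conv_lhs => rw [← hsol]
      conv_rhs => rw [← hv]
      rw [infoMat_mulVec_dotProduct, infoMat_mulVec_dotProduct]
      exact Finset.sum_congr rfl fun i _ => by rw [dotProduct_comm]
    rw [hsymm, dotProduct_smul, hgap, smul_eq_mul, sq]
  refine ⟨u, μ, h, hu, hμ, fun v hv => hgap ▸ dotProduct_le_sum_of_feas hv hμ,
    fun ν k hν => hgap.ge.trans <| dotProduct_le_sum_of_feas hu hν, hgap,
    ⟨⟨fun i => ?_, ?_⟩, ⟨_, hsol⟩, ?_⟩,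
    fun v hv => ?_⟩
  · exact mul_nonneg (inv_nonneg.2 (Finset.sum_nonneg fun i _ => hμ0 i)) (hμ0 i)
  · simp only [Pi.smul_apply, smul_eq_mul, ← Finset.mul_sum, ← hNdef]
    exact inv_mul_cancel₀ hN
  · intro w' v v' hw' hv hv'
    rw [hvar v hv, ← hgap]
    exact sq_dotProduct_le_variance hu hw' hv'
  · rw [hvar v hv, hgap]
    simp [N]
end

section
/- Let A_1,…,A_s be real l×m matrices and let K be a nonzero real m×r matrix whose range is contained in the range of Σ_{i=1}^s A_i^T A_i. Then the supremum of trace(K^T U) over {U ∈ ℝ^{m×r} : ‖A_i U‖_F ≤ 1 for all i ∈ {1,…,s}} is attained by some U*, the infimum of Σ_{i=1}^s μ_i over {(μ, H_1,…,H_s) : μ ∈ ℝ^s, H_i ∈ ℝ^{l×r}, K = Σ_{i=1}^s A_i^T H_i, and ‖H_i‖_F ≤ μ_i for all i} is attained by some (μ*, H*), and the two optimal values coincide: trace(K^T U*) = Σ_i μ_i*. Moreover, setting t := (Σ_i μ_i*)^{−1} and w := t·μ*, the vector w is an A-optimal design for K^T θ, and the optimal A-criterion value is Φ_K(w) = t^{−2}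 = (Σ_i μ_i*)² = (trace(K^T U*))². -/
open Matrix BigOperators

/-- Frobenius norm of a real matrix. -/
noncomputable def frobNorm {n p : ℕ} (B : Matrix (Fin n) (Fin p) ℝ) : ℝ :=
  Real.sqrt (∑ i, ∑ j, B i j ^ 2)

/-- `w` is feasible for `K` when the range of `K` is contained in the range of `M(w)`. -/
def FeasibleForK {s l m r : ℕ} (A : Fin s → Matrix (Fin l) (Fin m) ℝ)
    (K : Matrix (Fin m) (Fin r) ℝ) (w : Fin s → ℝ) : Prop :=
  ∀ x : Fin r → ℝ, ∃ u, infoMat A w *ᵥ u = K *ᵥ x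

/-- `w` is an `A`-optimal design for `Kᵀθ`: it is a feasible design and minimizes the
`A`-criterion `Φ_K(w') = ∑ k, c_k ⬝ᵥ u'_k` (where `M(w') u'_k = c_k`, `c_k` the columns of `K`)
among feasible designs. -/
def IsAOptimal {s l m r : ℕ} (A : Fin s → Matrix (Fin l) (Fin m) ℝ)
    (K : Matrix (Fin m) (Fin r) ℝ) (w : Fin s → ℝ) : Prop :=
  IsDesign w ∧ FeasibleForK A K w ∧
    ∀ (w' : Fin s → ℝ) (u u' : Fin r → Fin m → ℝ), IsDesign w' →
      (∀ k, infoMat A w *ᵥ u k = fun j => K j k) →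
      (∀ k, infoMat A w' *ᵥ u' k = fun j => K j k) →
        ∑ k, (fun j => K j k) ⬝ᵥ u k ≤ ∑ k, (fun j => K j k) ⬝ᵥ u' k

/-- Feasibility for the primal `A`-optimality SOCP: `‖A i U‖_F ≤ 1` for all `i`. -/
def PrimalAFeas {s l m r : ℕ} (A : Fin s → Matrix (Fin l) (Fin m) ℝ)
    (U : Matrix (Fin m) (Fin r) ℝ) : Prop :=
  ∀ i, frobNorm (A i * U) ≤ 1

/-- Feasibility for the dual `A`-optimality SOCP: `K = ∑ i, A iᵀ H i` and `‖H i‖_F ≤ μ i`. -/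
def DualAFeas {s l m r : ℕ} (A : Fin s → Matrix (Fin l) (Fin m) ℝ)
    (K : Matrix (Fin m) (Fin r) ℝ) (μ : Fin s → ℝ)
    (H : Fin s → Matrix (Fin l) (Fin r) ℝ) : Prop :=
  (K = ∑ i, (A i)ᵀ * H i) ∧ ∀ i, frobNorm (H i) ≤ μ i

open scoped Matrix.Norms.Frobenius

/-- In a finite-dimensional normed space, the minimum-norm solution of a consistent linear system
exists and is certified by a linear functional of the right-hand side. -/
theorem LinearMap.exists_min_norm_and_dual {E F : Type*} [NormedAddCommGroup E] [NormedSpace ℝ E]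
    [FiniteDimensional ℝ E] [AddCommGroup F] [Module ℝ F] (L : E →ₗ[ℝ] F) (x₀ : E) :
    ∃ x, L x = L x₀ ∧ ∃ g : F →ₗ[ℝ] ℝ, g (L x) = ‖x‖ ∧ ∀ y, g (L y) ≤ ‖y‖ := by
  have hcl : IsClosed {y | y - x₀ ∈ (LinearMap.ker L : Set E)} :=
    (Submodule.closed_of_finiteDimensional (LinearMap.ker L)).preimage (by fun_prop)
  have hproper : ProperSpace E := FiniteDimensional.proper ℝ E
  obtain ⟨x, hx, hmin⟩ := hcl.exists_infDist_eq_dist ⟨x₀, by simp⟩ 0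
  have hxL : L x = L x₀ := by simpa [sub_eq_zero] using hx
  have hle : ∀ y, L y = L x → ‖x‖ ≤ ‖y‖ := fun y hy => by
    have h := Metric.infDist_le_dist_of_mem (x := (0 : E))
      (show y ∈ {y | y - x₀ ∈ (LinearMap.ker L : Set E)} by simp [hy, hxL])
    rwa [hmin, dist_zero_left, dist_zero_left] at h
  obtain ⟨f, hf1, hf⟩ := exists_dual_vector'' ℝ ((LinearMap.ker L).mkQ x)
  have hnorm : ‖x‖ ≤ ‖(LinearMap.ker L).mkQ x‖ := by
    refine (QuotientAddGroup.le_norm_iff (S := (LinearMap.ker L).toAddSubgroup)).2 fun y hy => ?_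
    refine hle y ?_
    have h := (Submodule.Quotient.eq (LinearMap.ker L)).1 hy
    simpa [sub_eq_zero] using h
  obtain ⟨p, hp⟩ := LinearMap.exists_leftInverse_of_injective
    ((LinearMap.ker L).liftQ L le_rfl) (Submodule.ker_liftQ_eq_bot _ _ _ le_rfl)
  have hpL : ∀ y, p (L y) = (LinearMap.ker L).mkQ y := fun y => by
    simpa using LinearMap.congr_fun hp ((LinearMap.ker L).mkQ y)
  have hmk : ∀ y, ‖(LinearMap.ker L).mkQ y‖ ≤ ‖y‖ := fun y => Submodule.Quotient.norm_mk_le _ y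
  refine ⟨x, hxL, f.toLinearMap ∘ₗ p, ?_, fun y => ?_⟩
  · simpa [hpL] using hf.trans (le_antisymm (hmk x) hnorm)
  · have h := f.le_of_opNorm_le hf1 ((LinearMap.ker L).mkQ y)
    rw [one_mul] at h
    simpa [hpL] using (le_abs_self _).trans (h.trans (hmk y))

theorem Matrix.exists_trace_transpose_mul_eq {m r : Type*} [Fintype m] [Fintype r]
    [DecidableEq m] [DecidableEq r] (g : Matrix m r ℝ →ₗ[ℝ] ℝ) :
    ∃ U : Matrix m r ℝ, ∀ X, g X = trace (Xᵀ * U) := by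
  refine ⟨of fun i j => g (single i j 1), fun X => ?_⟩
  conv_lhs => rw [matrix_eq_sum_single X]
  simp only [map_sum, trace, diag, mul_apply, transpose_apply, of_apply]
  rw [Finset.sum_comm]
  refine Finset.sum_congr rfl fun j _ => Finset.sum_congr rfl fun i _ => ?_
  rw [← smul_eq_mul, ← map_smul, smul_single, smul_eq_mul, mul_one]

theorem frobNorm_eq_norm {n p : ℕ} (B : Matrix (Fin n) (Fin p) ℝ) : frobNorm B = ‖B‖ := by
  simp [frobNorm, frobenius_norm_def, Real.sqrt_eq_rpow]

theorem Matrix.trace_transpose_mul_eq_sum {n p : Type*} [Fintype n] [Fintype p]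
    (B C : Matrix n p ℝ) : trace (Bᵀ * C) = ∑ i, ∑ j, B i j * C i j := by
  simp only [trace, diag, mul_apply, transpose_apply]
  exact Finset.sum_comm

theorem Matrix.trace_transpose_mul_self {n p : ℕ} (B : Matrix (Fin n) (Fin p) ℝ) :
    trace (Bᵀ * B) = ‖B‖ ^ 2 := by
  rw [← frobNorm_eq_norm, frobNorm, Real.sq_sqrt (by positivity), trace_transpose_mul_eq_sum]
  simp [sq]

theorem Matrix.trace_transpose_mul_le_norm_mul_norm {n p : ℕ} (B C : Matrix (Fin n) (Fin p) ℝ) :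
    trace (Bᵀ * C) ≤ ‖B‖ * ‖C‖ := by
  rw [trace_transpose_mul_eq_sum, ← frobNorm_eq_norm, ← frobNorm_eq_norm]
  simpa [frobNorm, Fintype.sum_prod_type] using Real.sum_mul_le_sqrt_mul_sqrt Finset.univ
    (fun x : Fin n × Fin p => B x.1 x.2) (fun x => C x.1 x.2)

/-- Equality case of the Cauchy-Schwarz inequality against a matrix in the unit ball. -/
theorem Matrix.eq_norm_smul_of_trace_eq_norm {n p : ℕ} {B C : Matrix (Fin n) (Fin p) ℝ}
    (hC : ‖C‖ ≤ 1) (h : trace (Bᵀ * C) = ‖B‖) : B = ‖B‖ • C := by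
  have hcomm : trace (Cᵀ * B) = ‖B‖ := by
    rw [← h, ← trace_transpose (Bᵀ * C), transpose_mul, transpose_transpose]
  have hexp : ‖B - ‖B‖ • C‖ ^ 2 = ‖B‖ ^ 2 * (‖C‖ ^ 2 - 1) := by
    rw [← trace_transpose_mul_self]
    simp only [transpose_sub, transpose_smul, Matrix.sub_mul, Matrix.mul_sub, Matrix.smul_mul,
      Matrix.mul_smul, trace_sub, trace_smul, h, hcomm, trace_transpose_mul_self, smul_eq_mul]
    ring
  have hC2 : ‖C‖ ^ 2 ≤ 1 := by nlinarith [norm_nonneg C]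
  have hzero : ‖B - ‖B‖ • C‖ ^ 2 = 0 :=
    le_antisymm (by rw [hexp]; nlinarith [sq_nonneg ‖B‖]) (sq_nonneg _)
  exact sub_eq_zero.1 (norm_eq_zero.1 (pow_eq_zero_iff two_ne_zero |>.1 hzero))

section Design

variable {s l m r : ℕ} (A : Fin s → Matrix (Fin l) (Fin m) ℝ)

theorem infoMat_mul (w : Fin s → ℝ) (Y : Matrix (Fin m) (Fin r) ℝ) :
    infoMat A w * Y = ∑ i, (A i)ᵀ * (w i • (A i * Y)) := by
  simp [infoMat, Matrix.sum_mul, Matrix.mul_assoc]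

theorem infoMat_transpose (w : Fin s → ℝ) : (infoMat A w)ᵀ = infoMat A w := by
  simp [infoMat, transpose_sum]

theorem infoMat_smul (c : ℝ) (w : Fin s → ℝ) : infoMat A (c • w) = c • infoMat A w := by
  simp [infoMat, Finset.smul_sum, smul_smul]

theorem trace_sum_transpose_mul (H : Fin s → Matrix (Fin l) (Fin r) ℝ)
    (U : Matrix (Fin m) (Fin r) ℝ) :
    trace ((∑ i, (A i)ᵀ * H i)ᵀ * U) = ∑ i, trace ((H i)ᵀ * (A i * U)) := by
  simp [transpose_sum, Matrix.sum_mul, trace_sum, Matrix.mul_assoc]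

/-- Column-wise solutions of `M(w) u k = c k` assemble to a matrix solution. -/
theorem infoMat_mul_eq_of_columns {K : Matrix (Fin m) (Fin r) ℝ} {w : Fin s → ℝ}
    {u : Fin r → Fin m → ℝ} (hu : ∀ k, infoMat A w *ᵥ u k = fun j => K j k) :
    infoMat A w * (of u)ᵀ = K := by
  ext j k
  exact congrFun (hu k) j

theorem sum_dotProduct_columns (K : Matrix (Fin m) (Fin r) ℝ) (u : Fin r → Fin m → ℝ) :
    ∑ k, (fun j => K j k) ⬝ᵥ u k = trace (Kᵀ * (of u)ᵀ) := rfl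

theorem trace_transpose_mul_eq_of_infoMat_mul {K Y Z : Matrix (Fin m) (Fin r) ℝ} {w : Fin s → ℝ}
    (hY : infoMat A w * Y = K) (hZ : infoMat A w * Z = K) : trace (Kᵀ * Y) = trace (Kᵀ * Z) := by
  have h : Kᵀ * Y = (Kᵀ * Z)ᵀ := by
    conv_lhs => rw [← hZ]
    rw [transpose_mul, infoMat_transpose, Matrix.mul_assoc, hY, transpose_mul, transpose_transpose]
  rw [h, trace_transpose]

theorem exists_eq_sum_transpose_mul {K : Matrix (Fin m) (Fin r) ℝ}
    (hrange : ∀ x : Fin r → ℝ, ∃ u, (∑ i, (A i)ᵀ * A i) *ᵥ u = K *ᵥ x) :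
    ∃ H : Fin s → Matrix (Fin l) (Fin r) ℝ, ∑ i, (A i)ᵀ * H i = K := by
  choose u hu using hrange
  refine ⟨fun i => A i * (of fun k => u (Pi.single k 1))ᵀ, ?_⟩
  simp_rw [← Matrix.mul_assoc, ← Matrix.sum_mul]
  ext j k
  have h := congrFun (hu (Pi.single k 1)) j
  rw [mulVec_single_one] at h
  exact h

/-- Strong duality, with attainment, for the two second-order cone programs. -/
theorem exists_primal_dual_optimal {K : Matrix (Fin m) (Fin r) ℝ}
    (hrange : ∀ x : Fin r → ℝ, ∃ u, (∑ i, (A i)ᵀ * A i) *ᵥ u = K *ᵥ x) :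
    ∃ (U : Matrix (Fin m) (Fin r) ℝ) (H : Fin s → Matrix (Fin l) (Fin r) ℝ),
      (∀ i, ‖A i * U‖ ≤ 1) ∧ ∑ i, (A i)ᵀ * H i = K ∧ trace (Kᵀ * U) = ∑ i, ‖H i‖ := by
  obtain ⟨H₀, hH₀⟩ := exists_eq_sum_transpose_mul A hrange
  let L : PiLp 1 (fun _ : Fin s => Matrix (Fin l) (Fin r) ℝ) →ₗ[ℝ] Matrix (Fin m) (Fin r) ℝ :=
    { toFun := fun H => ∑ i, (A i)ᵀ * H i
      map_add' := fun x y => by simp [Matrix.mul_add, Finset.sum_add_distrib]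
      map_smul' := fun c x => by simp [Finset.smul_sum] }
  obtain ⟨H, hH, g, hg, hgle⟩ := L.exists_min_norm_and_dual (WithLp.toLp 1 H₀)
  have hK : L H = K := hH.trans hH₀
  obtain ⟨U, hU⟩ := Matrix.exists_trace_transpose_mul_eq g
  refine ⟨U, fun i => H i, fun i => ?_, hK, ?_⟩
  · have h := hgle (PiLp.single 1 i (A i * U))
    have hL : L (PiLp.single 1 i (A i * U)) = (A i)ᵀ * (A i * U) := by
      change ∑ j, (A j)ᵀ * (PiLp.single 1 i (A i * U) :
        PiLp 1 fun _ : Fin s => Matrix (Fin l) (Fin r) ℝ) j = _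
      rw [Finset.sum_eq_single i] <;> simp +contextual
    rw [PiLp.norm_single, hU, hL, transpose_mul, transpose_transpose, Matrix.mul_assoc,
      trace_transpose_mul_self] at h
    by_contra! hlt
    nlinarith
  · rw [← hU, ← hK, hg, PiLp.norm_eq_of_L1]

theorem trace_le_sum_of_feasible {K U : Matrix (Fin m) (Fin r) ℝ} {μ : Fin s → ℝ}
    {H : Fin s → Matrix (Fin l) (Fin r) ℝ} (hU : PrimalAFeas A U) (hH : DualAFeas A K μ H) :
    trace (Kᵀ * U) ≤ ∑ i, μ i := by
  rw [hH.1, trace_sum_transpose_mul]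
  refine Finset.sum_le_sum fun i _ => (trace_transpose_mul_le_norm_mul_norm _ _).trans ?_
  have hUi := hU i
  have hHi := hH.2 i
  rw [frobNorm_eq_norm] at hUi hHi
  exact (mul_le_of_le_one_right (norm_nonneg _) hUi).trans hHi

/-- The `A`-criterion of a design dominates the squared optimal value of the dual program. -/
theorem sq_le_trace_of_isDesign {K Y : Matrix (Fin m) (Fin r) ℝ} {σ : ℝ} {w : Fin s → ℝ}
    (hσ : 0 ≤ σ) (hdual : ∀ μ H, DualAFeas A K μ H → σ ≤ ∑ i, μ i) (hw : IsDesign w)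
    (hY : infoMat A w * Y = K) : σ ^ 2 ≤ trace (Kᵀ * Y) := by
  have hlin : σ ≤ ∑ i, w i * ‖A i * Y‖ := by
    refine hdual _ (fun i => w i • (A i * Y)) ⟨by rw [← hY, infoMat_mul], fun i => ?_⟩
    rw [frobNorm_eq_norm, norm_smul, Real.norm_of_nonneg (hw.1 i)]
  have hquad : trace (Kᵀ * Y) = ∑ i, w i * ‖A i * Y‖ ^ 2 := by
    rw [← hY, infoMat_mul, trace_sum_transpose_mul]
    simp only [transpose_smul, Matrix.smul_mul, trace_smul, trace_transpose_mul_self, smul_eq_mul]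
  have hvar : 0 ≤ ∑ i, w i * (‖A i * Y‖ - σ) ^ 2 :=
    Finset.sum_nonneg fun i _ => mul_nonneg (hw.1 i) (sq_nonneg _)
  have hexp : ∑ i, w i * (‖A i * Y‖ - σ) ^ 2 =
      ∑ i, w i * ‖A i * Y‖ ^ 2 - 2 * σ * ∑ i, w i * ‖A i * Y‖ + σ ^ 2 * ∑ i, w i := by
    simp only [Finset.mul_sum, ← Finset.sum_sub_distrib, ← Finset.sum_add_distrib]
    exact Finset.sum_congr rfl fun i _ => by ring
  rw [hexp, hw.2] at hvar
  nlinarith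

end Design

/-- **Computation of the `A`-optimal design by SOCP.** Both the primal and dual
second-order cone programs are attained, their values coincide, and the normalized
dual solution `w := (∑ μ*)⁻¹ • μ*` is an `A`-optimal design for `Kᵀθ`, with optimal
`A`-criterion `t⁻² = (∑ μ*)² = (trace Kᵀ U*)²`. -/
theorem aOptimal_SOCP {s l m r : ℕ} (A : Fin s → Matrix (Fin l) (Fin m) ℝ)
    (K : Matrix (Fin m) (Fin r) ℝ) (hK : K ≠ 0)
    (hrange : ∀ x : Fin r → ℝ, ∃ u, (∑ i, (A i)ᵀ * A i) *ᵥ u = K *ᵥ x) :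
    ∃ (Ustar : Matrix (Fin m) (Fin r) ℝ) (μstar : Fin s → ℝ)
      (Hstar : Fin s → Matrix (Fin l) (Fin r) ℝ),
      PrimalAFeas A Ustar ∧ DualAFeas A K μstar Hstar ∧
      (∀ U, PrimalAFeas A U → Matrix.trace (Kᵀ * U) ≤ Matrix.trace (Kᵀ * Ustar)) ∧
      (∀ μ H, DualAFeas A K μ H → ∑ i, μstar i ≤ ∑ i, μ i) ∧
      Matrix.trace (Kᵀ * Ustar) = ∑ i, μstar i ∧
      IsAOptimal A K ((∑ i, μstar i)⁻¹ • μstar) ∧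
      (∀ u : Fin r → Fin m → ℝ,
        (∀ k, infoMat A ((∑ i, μstar i)⁻¹ • μstar) *ᵥ u k = fun j => K j k) →
        ∑ k, (fun j => K j k) ⬝ᵥ u k = (∑ i, μstar i) ^ 2 ∧
        ∑ k, (fun j => K j k) ⬝ᵥ u k = (Matrix.trace (Kᵀ * Ustar)) ^ 2 ∧
        ∑ k, (fun j => K j k) ⬝ᵥ u k = (((∑ i, μstar i)⁻¹) ^ 2)⁻¹) := by
  obtain ⟨U, H, hU, hH, hval⟩ := exists_primal_dual_optimal A hrange
  have hprimal : PrimalAFeas A U := fun i => (frobNorm_eq_norm _).trans_le (hU i)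
  have hdual : DualAFeas A K (fun i => ‖H i‖) H := ⟨hH.symm, fun i => (frobNorm_eq_norm _).le⟩
  set μ : Fin s → ℝ := fun i => ‖H i‖ with hμ
  set σ := ∑ i, μ i with hσdef
  have hopt : ∀ ν G, DualAFeas A K ν G → σ ≤ ∑ i, ν i := fun ν G h =>
    hval.symm.le.trans (trace_le_sum_of_feasible A hprimal h)
  have hσ0 : 0 ≤ σ := Finset.sum_nonneg fun i _ => norm_nonneg _
  have hσ : 0 < σ := by
    refine hσ0.lt_of_ne' fun h0 => hK ?_
    have hzero := (Finset.sum_eq_zero_iff_of_nonneg fun i _ => norm_nonneg (H i)).1 h0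
    rw [← hH]
    exact Finset.sum_eq_zero fun i hi => by rw [norm_eq_zero.1 (hzero i hi), Matrix.mul_zero]
  have htight : ∀ i, trace ((H i)ᵀ * (A i * U)) = ‖H i‖ := by
    have hle : ∀ i ∈ Finset.univ, trace ((H i)ᵀ * (A i * U)) ≤ ‖H i‖ := fun i _ =>
      (trace_transpose_mul_le_norm_mul_norm _ _).trans
        (mul_le_of_le_one_right (norm_nonneg _) (hU i))
    rw [← hH, trace_sum_transpose_mul] at hval
    exact fun i => (Finset.sum_eq_sum_iff_of_le hle).1 hval i (Finset.mem_univ i)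
  have hsol : infoMat A (σ⁻¹ • μ) * (σ • U) = K := by
    rw [infoMat_smul, Matrix.smul_mul, Matrix.mul_smul, smul_smul, inv_mul_cancel₀ hσ.ne',
      one_smul, infoMat_mul, ← hH]
    exact Finset.sum_congr rfl fun i _ => by
      rw [← eq_norm_smul_of_trace_eq_norm (hU i) (htight i)]
  have hcrit : ∀ u : Fin r → Fin m → ℝ,
      (∀ k, infoMat A (σ⁻¹ • μ) *ᵥ u k = fun j => K j k) →
        ∑ k, (fun j => K j k) ⬝ᵥ u k = σ ^ 2 := fun u hu => by
    rw [sum_dotProduct_columns, trace_transpose_mul_eq_of_infoMat_mul A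
      (infoMat_mul_eq_of_columns A hu) hsol, Matrix.mul_smul, trace_smul, hval, smul_eq_mul, sq]
  refine ⟨U, μ, H, hprimal, hdual, fun V hV => ?_, hopt, hval, ⟨⟨fun i => ?_, ?_⟩, fun x => ?_, ?_⟩,
    fun u hu => ⟨hcrit u hu, by rw [hval]; exact hcrit u hu, by simpa using hcrit u hu⟩⟩
  · exact (trace_le_sum_of_feasible A hV hdual).trans hval.ge
  · exact mul_nonneg (inv_nonneg.2 hσ0) (norm_nonneg _)
  · simp only [Pi.smul_apply, ← Finset.smul_sum]
    exact inv_mul_cancel₀ hσ.ne'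
  · exact ⟨(σ • U) *ᵥ x, by rw [mulVec_mulVec, hsol]⟩
  · intro w' u u' hw' hu hu'
    rw [hcrit u hu, sum_dotProduct_columns]
    exact sq_le_trace_of_isDesign A hσ0 hopt hw' (infoMat_mul_eq_of_columns A hu')
end

section
/- Let A_1,…,A_s be real l×m matrices, K a real r×m matrix, and b ∈ ℝ^s. Consider the feasible set 𝒳 := {X ∈ ℝ^{m×m} symmetric : X positive semidefinite and trace(A_i X A_i^T) ≤ b_i for all i ∈ {1,…,s}} of the semidefinite packing program maximizing trace(K^T K X) over 𝒳. Then: (1) 𝒳 is nonempty if and only if b_i ≥ 0 for every i; (2) if b_i ≥ 0 for every i, then the supremum of trace(K^T K X) over 𝒳 is finite if and only if the range of K^T is contained in the range of Σ_{i=1}^s A_i^T A_i. -/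
open Matrix BigOperators

/-- Feasible set of the semidefinite packing program: `X` symmetric positive semidefinite
with `trace (A i X A iᵀ) ≤ b i` for all `i`. -/
def PackFeas {s l m : ℕ} (A : Fin s → Matrix (Fin l) (Fin m) ℝ) (b : Fin s → ℝ)
    (X : Matrix (Fin m) (Fin m) ℝ) : Prop :=
  X.PosSemidef ∧ ∀ i, Matrix.trace (A i * X * (A i)ᵀ) ≤ b i

open scoped Matrix.Norms.Frobenius in
theorem Matrix.trace_mul_transpose_self_eq_frobenius_norm_sq {p q : Type*} [Fintype p] [Fintype q]
    (C : Matrix p q ℝ) : (C * Cᵀ).trace = ‖C‖ ^ 2 := by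
  rw [Matrix.frobenius_norm_def, ← Real.sqrt_eq_rpow, Real.sq_sqrt (by positivity)]
  simp [Matrix.trace, Matrix.mul_apply, sq]

open scoped MatrixOrder Matrix.Norms.L2Operator in
theorem Matrix.PosSemidef.exists_eq_mul_transpose {n : Type*} [Fintype n] [DecidableEq n]
    {X : Matrix n n ℝ} (hX : X.PosSemidef) : ∃ B : Matrix n n ℝ, X = B * Bᵀ := by
  obtain ⟨B, rfl⟩ := CStarAlgebra.nonneg_iff_eq_star_mul_self.mp hX.nonneg
  exact ⟨Bᵀ, by simp [Matrix.star_eq_conjTranspose]⟩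

theorem Matrix.trace_mul_mul_transpose_nonneg {p q : Type*} [Fintype p] [Fintype q]
    {X : Matrix q q ℝ} (hX : X.PosSemidef) (C : Matrix p q ℝ) : 0 ≤ (C * X * Cᵀ).trace := by
  simpa using (hX.mul_mul_conjTranspose_same C).trace_nonneg

/-- A vector orthogonal to the kernel of `M` lies in the range of `Mᵀ`. -/
theorem Matrix.exists_transpose_mulVec_eq {p q : Type*} [Fintype p] [Fintype q]
    (M : Matrix p q ℝ) (w : q → ℝ) (h : ∀ v, M *ᵥ v = 0 → w ⬝ᵥ v = 0) :
    ∃ u, Mᵀ *ᵥ u = w := by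
  classical
  have hw := mem_span_of_iInf_ker_le_ker (L := fun i => dotProductBilin ℝ ℝ (M i))
    (K := dotProductBilin ℝ ℝ w) fun v hv => h v <| by
      ext i
      exact (Submodule.mem_iInf _).1 hv i
  obtain ⟨c, hc⟩ := (Submodule.mem_span_range_iff_exists_fun ℝ).1 hw
  refine ⟨c, ?_⟩
  ext j
  simpa [Matrix.mulVec_transpose, Matrix.vecMul, dotProduct, Pi.single_apply] using
    congrArg (fun f : (q → ℝ) →ₗ[ℝ] ℝ => f (Pi.single j 1)) hc

theorem Matrix.mulVec_eq_zero_of_sum_transpose_mul_self {ι p q : Type*} [Fintype ι] [Fintype p]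
    [Fintype q] (A : ι → Matrix p q ℝ) {v : q → ℝ} (hv : (∑ i, (A i)ᵀ * A i) *ᵥ v = 0) (i : ι) :
    A i *ᵥ v = 0 := by
  have hsum : ∑ i, (A i *ᵥ v) ⬝ᵥ (A i *ᵥ v) = 0 := by
    have h := congrArg (v ⬝ᵥ ·) hv
    simpa [Matrix.sum_mulVec, dotProduct_sum, ← Matrix.mulVec_mulVec, Matrix.dotProduct_mulVec,
      Matrix.vecMul_transpose] using h
  exact dotProduct_self_eq_zero.1 <|
    (Finset.sum_eq_zero_iff_of_nonneg fun i _ => by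
      simpa using dotProduct_star_self_nonneg (A i *ᵥ v)).1 hsum i
      (Finset.mem_univ i)

theorem Matrix.trace_mul_vecMulVec_mul_transpose {p q : Type*} [Fintype p] [Fintype q]
    (C : Matrix p q ℝ) (v : q → ℝ) :
    (C * vecMulVec v v * Cᵀ).trace = (C *ᵥ v) ⬝ᵥ (C *ᵥ v) := by
  rw [Matrix.mul_vecMulVec, Matrix.vecMulVec_mul, Matrix.vecMul_transpose, Matrix.trace_vecMulVec]

open scoped Matrix.Norms.Frobenius in
theorem Matrix.bddAbove_trace_of_range_le {s l m r : ℕ} (A : Fin s → Matrix (Fin l) (Fin m) ℝ)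
    (K : Matrix (Fin r) (Fin m) ℝ) (b : Fin s → ℝ)
    (h : ∀ y : Fin r → ℝ, ∃ u, (∑ i, (A i)ᵀ * A i) *ᵥ u = Kᵀ *ᵥ y) :
    BddAbove ((fun X => Matrix.trace (Kᵀ * K * X)) '' {X | PackFeas A b X}) := by
  choose g hg using fun j : Fin r => h (Pi.single j 1)
  let U : Matrix (Fin r) (Fin m) ℝ := Matrix.of g
  have hKt : Kᵀ = (∑ i, (A i)ᵀ * A i) * Uᵀ := by
    ext a j
    have hja := (congrFun (hg j) a).symm
    rwa [Matrix.mulVec_single_one] at hja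
  have hK : K = ∑ i, U * (A i)ᵀ * A i := by
    rw [← Matrix.transpose_inj, hKt]
    simp [Matrix.transpose_sum, Matrix.sum_mul, Matrix.mul_assoc]
  refine ⟨(∑ i, ‖U * (A i)ᵀ‖ * √(b i)) ^ 2, ?_⟩
  rintro _ ⟨X, ⟨hX, hA⟩, rfl⟩
  obtain ⟨B, rfl⟩ := hX.exists_eq_mul_transpose
  have hAB (i) : ‖A i * B‖ ≤ √(b i) := by
    refine Real.le_sqrt_of_sq_le ?_
    rw [← Matrix.trace_mul_transpose_self_eq_frobenius_norm_sq]
    simpa [Matrix.mul_assoc] using hA i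
  have hKB : (Kᵀ * K * (B * Bᵀ)).trace = ‖K * B‖ ^ 2 := by
    rw [← Matrix.trace_mul_transpose_self_eq_frobenius_norm_sq, Matrix.mul_assoc,
      Matrix.trace_mul_comm]
    simp [Matrix.mul_assoc]
  dsimp only
  rw [hKB]
  gcongr
  calc ‖K * B‖ = ‖∑ i, U * (A i)ᵀ * (A i * B)‖ := by
        conv_lhs => rw [hK, Matrix.sum_mul]
        simp only [Matrix.mul_assoc]
    _ ≤ ∑ i, ‖U * (A i)ᵀ * (A i * B)‖ := norm_sum_le _ _
    _ ≤ ∑ i, ‖U * (A i)ᵀ‖ * √(b i) := by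
        gcongr with i
        exact (Matrix.frobenius_norm_mul _ _).trans (by gcongr; exact hAB i)

theorem Matrix.mulVec_eq_zero_of_bddAbove_trace {s l m r : ℕ}
    (A : Fin s → Matrix (Fin l) (Fin m) ℝ) (K : Matrix (Fin r) (Fin m) ℝ) {b : Fin s → ℝ}
    (hb : ∀ i, 0 ≤ b i)
    (hbdd : BddAbove ((fun X => Matrix.trace (Kᵀ * K * X)) '' {X | PackFeas A b X}))
    {v : Fin m → ℝ} (hv : ∀ i, A i *ᵥ v = 0) : K *ᵥ v = 0 := by
  obtain ⟨c, hc⟩ := hbdd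
  have key (t : ℝ) : t ^ 2 * ((K *ᵥ v) ⬝ᵥ (K *ᵥ v)) ≤ c := by
    refine hc ⟨vecMulVec (t • v) (t • v), ⟨?_, fun i => ?_⟩, ?_⟩
    · simpa using posSemidef_vecMulVec_self_star (t • v)
    · rw [Matrix.trace_mul_vecMulVec_mul_transpose, Matrix.mulVec_smul, hv i]
      simpa using hb i
    · dsimp only
      rw [Matrix.mul_assoc, Matrix.trace_mul_comm, Matrix.trace_mul_vecMulVec_mul_transpose,
        Matrix.mulVec_smul]
      simp [sq, mul_assoc]
  by_contra hne
  have hpos : 0 < (K *ᵥ v) ⬝ᵥ (K *ᵥ v) :=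
    lt_of_le_of_ne (by simpa using dotProduct_star_self_nonneg (K *ᵥ v)) fun h => hne (dotProduct_self_eq_zero.1 h.symm)
  have hc0 : 0 ≤ c := by simpa using key 0
  have := key √((c + 1) / ((K *ᵥ v) ⬝ᵥ (K *ᵥ v)))
  rw [Real.sq_sqrt (by positivity), div_mul_cancel₀ _ hpos.ne'] at this
  linarith

/-- **Feasibility and boundedness of semidefinite packing programs.**
(1) The feasible set is nonempty iff every `b i` is nonnegative;
(2) when `b ≥ 0`, the supremum of `trace (Kᵀ K X)` over the feasible set is finite iff
the range of `Kᵀ` is contained in the range of `∑ i, A iᵀ A i`. -/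
theorem packingSDP_feasible_bounded {s l m r : ℕ}
    (A : Fin s → Matrix (Fin l) (Fin m) ℝ) (K : Matrix (Fin r) (Fin m) ℝ)
    (b : Fin s → ℝ) :
    ((∃ X, PackFeas A b X) ↔ ∀ i, 0 ≤ b i) ∧
    ((∀ i, 0 ≤ b i) →
      (BddAbove ((fun X => Matrix.trace (Kᵀ * K * X)) '' {X | PackFeas A b X}) ↔
        ∀ y : Fin r → ℝ, ∃ u, (∑ i, (A i)ᵀ * A i) *ᵥ u = Kᵀ *ᵥ y)) := by
  refine ⟨⟨fun ⟨X, hX, hA⟩ i => (Matrix.trace_mul_mul_transpose_nonneg hX (A i)).trans (hA i),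
    fun hb => ⟨0, PosSemidef.zero, fun i => by simpa using hb i⟩⟩, fun hb => ⟨fun hbdd y => ?_,
    Matrix.bddAbove_trace_of_range_le A K b⟩⟩
  obtain ⟨u, hu⟩ := Matrix.exists_transpose_mulVec_eq (∑ i, (A i)ᵀ * A i) (Kᵀ *ᵥ y) fun v hv => by
    rw [Matrix.mulVec_transpose, ← Matrix.dotProduct_mulVec,
      Matrix.mulVec_eq_zero_of_bddAbove_trace A K hb hbdd
        (Matrix.mulVec_eq_zero_of_sum_transpose_mul_self A hv), dotProduct_zero]
  exact ⟨u, by simpa [Matrix.transpose_sum] using hu⟩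
end

section
/- Let A_1,…,A_s be real l×m matrices, K a real r×m matrix, and b ∈ ℝ^s with b_i ≥ 0 for all i, and suppose the range of K^T is contained in the range of Σ_{i=1}^s A_i^T A_i. Then the semidefinite packing program maximizing trace(K^T K X) over 𝒳 := {X ∈ ℝ^{m×m} symmetric : X positive semidefinite, trace(A_i X A_i^T) ≤ b_i for all i} has an optimal solution X* ∈ 𝒳 (i.e. trace(K^T K X*) = sup_{X ∈ 𝒳} trace(K^T K X)) whose rank satisfies rank(X*) ≤ rank(K^T K) = rank(K). -/
open Matrix BigOperators

namespace Matrix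

/-- Every matrix over a field has a generalized (von Neumann) inverse. -/
theorem exists_mul_mul_eq_self {F m n : Type*} [Field F] [Fintype m] [Fintype n]
    (G : Matrix m n F) : ∃ H : Matrix n m F, G * H * G = G := by
  classical
  obtain ⟨g, hg⟩ := LinearMap.exists_rightInverse_of_surjective (toLin' G).rangeRestrict
    (toLin' G).range_rangeRestrict
  obtain ⟨h, hh⟩ := LinearMap.exists_extend g
  refine ⟨LinearMap.toMatrix' h, toLin'.injective ?_⟩
  rw [toLin'_mul, toLin'_mul, toLin'_toMatrix']
  refine LinearMap.ext fun x => ?_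
  have h1 : h (toLin' G x) = g ((toLin' G).rangeRestrict x) :=
    LinearMap.congr_fun hh ((toLin' G).rangeRestrict x)
  have h2 := congrArg Subtype.val (LinearMap.congr_fun hg ((toLin' G).rangeRestrict x))
  rw [LinearMap.comp_apply, LinearMap.comp_apply, h1]
  exact h2

/-- The orthogonal projection onto the row space of a real matrix. -/
theorem exists_rowSpace_projection {m n : Type*} [Fintype m] [Fintype n]
    (N : Matrix m n ℝ) :
    ∃ P : Matrix n n ℝ, Pᵀ = P ∧ P * P = P ∧ N * P = N ∧ P.rank ≤ N.rank := by
  obtain ⟨J, hJ⟩ := exists_mul_mul_eq_self (N * Nᵀ)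
  set P : Matrix n n ℝ := Nᵀ * J * N with hP
  have hN : P * Nᵀ = Nᵀ := by
    have h0 : N * (P * Nᵀ - Nᵀ) = 0 := by
      rw [Matrix.mul_sub, sub_eq_zero, ← hJ]
      simp only [hP, Matrix.mul_assoc]
    have h1 : (P * Nᵀ - Nᵀ)ᵀ * (P * Nᵀ - Nᵀ) = 0 := by
      have h2 : P * Nᵀ - Nᵀ = Nᵀ * (J * N * Nᵀ) - Nᵀ := by
        simp only [hP, Matrix.mul_assoc]
      have h3 : (P * Nᵀ - Nᵀ)ᵀ = (J * N * Nᵀ)ᵀ * N - N := by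
        rw [h2, transpose_sub, transpose_mul, transpose_transpose]
      rw [h3, Matrix.sub_mul, Matrix.mul_assoc, h0, Matrix.mul_zero, sub_zero]
    rw [← conjTranspose_eq_transpose_of_trivial, conjTranspose_mul_self_eq_zero] at h1
    exact sub_eq_zero.mp h1
  have hPP : P * Pᵀ = Pᵀ := by
    have h1 : Pᵀ = Nᵀ * (Jᵀ * N) := by
      simp only [hP, transpose_mul, transpose_transpose]
    rw [h1, ← Matrix.mul_assoc, hN]
  have hs : Pᵀ = P := by
    have h1 := congrArg transpose hPP
    rwa [transpose_mul, transpose_transpose, hPP] at h1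
  refine ⟨P, hs, by rwa [hs] at hPP, ?_, rank_mul_le_right _ _⟩
  have h1 := congrArg transpose hN
  rwa [transpose_mul, transpose_transpose, hs] at h1

theorem PosSemidef.abs_apply_le_trace {n : Type*} [Fintype n] {Z : Matrix n n ℝ}
    (hZ : Z.PosSemidef) (i j : n) : |Z i j| ≤ Z.trace := by
  classical
  have hle (k : n) : Z k k ≤ Z.trace :=
    Finset.single_le_sum (f := fun k => Z k k) (fun k _ => hZ.diag_nonneg) (Finset.mem_univ k)
  have hsymm : Z j i = Z i j := by simpa using hZ.isHermitian.apply i j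
  have hadd := hZ.dotProduct_mulVec_nonneg (Pi.single i 1 + Pi.single j 1)
  have hsub := hZ.dotProduct_mulVec_nonneg (Pi.single i 1 - Pi.single j 1)
  simp [mulVec_add, mulVec_sub, add_dotProduct, sub_dotProduct, hsymm] at hadd hsub
  have hi := hle i
  have hj := hle j
  rw [abs_le]
  constructor <;> linarith

theorem isClosed_setOf_posSemidef {n : Type*} [Fintype n] :
    IsClosed {Z : Matrix n n ℝ | Z.PosSemidef} := by
  simp only [posSemidef_iff_dotProduct_mulVec, Set.ofPred_and, Set.ofPred_forall]
  refine IsClosed.inter ?_ (isClosed_iInter fun x => ?_)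
  · exact isClosed_eq (by fun_prop) continuous_id
  · exact isClosed_le continuous_const (by fun_prop)

theorem isCompact_posSemidef_trace_le {n : Type*} [Fintype n] (T : ℝ) :
    IsCompact {Z : Matrix n n ℝ | Z.PosSemidef ∧ Z.trace ≤ T} := by
  have hbox : IsCompact (Set.univ.pi fun _ : n => Set.univ.pi fun _ : n => Set.Icc (-T) T) :=
    isCompact_univ_pi fun _ => isCompact_univ_pi fun _ => isCompact_Icc
  refine IsCompact.of_isClosed_subset (X := Matrix n n ℝ) hbox
    (isClosed_setOf_posSemidef.inter (isClosed_le (f := trace)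
      (by fun_prop) continuous_const)) ?_
  rintro Z ⟨hZ, hT⟩ i - j -
  exact abs_le.mp ((hZ.abs_apply_le_trace i j).trans hT)

end Matrix

theorem PackFeas.exists_isMax {s l m r : ℕ}
    (A : Fin s → Matrix (Fin l) (Fin m) ℝ) (K : Matrix (Fin r) (Fin m) ℝ)
    (b : Fin s → ℝ) (hb : ∀ i, 0 ≤ b i)
    (hrange : ∀ y : Fin r → ℝ, ∃ u, (∑ i, (A i)ᵀ * A i) *ᵥ u = Kᵀ *ᵥ y) :
    ∃ X, PackFeas A b X ∧
      ∀ Y, PackFeas A b Y → trace (K * Y * Kᵀ) ≤ trace (K * X * Kᵀ) := by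
  let G : Matrix (Fin s × Fin l) (Fin m) ℝ := of fun p j => A p.1 p.2 j
  obtain ⟨H, hH⟩ := exists_mul_mul_eq_self G
  have hA (i : Fin s) : A i * (H * G) = A i := by
    ext a j
    have h1 := congrFun₂ hH (i, a) j
    rw [Matrix.mul_assoc] at h1
    exact h1
  have hGG : ∑ i, (A i)ᵀ * A i = Gᵀ * G := by
    ext j k
    simp [G, Matrix.mul_apply, Matrix.sum_apply, Fintype.sum_prod_type]
  have hK : K * (H * G) = K := by
    choose u hu using fun k : Fin r => hrange (Pi.single k 1)
    have hKG : K = (of fun k => G *ᵥ u k) * G := by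
      ext k j
      have h1 := congrFun (hu k) j
      rw [hGG, ← mulVec_mulVec] at h1
      simp only [mulVec_single_one, col_apply, transpose_apply] at h1
      rw [← h1]
      simp [mulVec, dotProduct, Matrix.mul_apply, mul_comm]
    rw [hKG, Matrix.mul_assoc, ← Matrix.mul_assoc G, hH]
  have hconj {n : ℕ} (B : Matrix (Fin n) (Fin m) ℝ) (hB : B * (H * G) = B)
      (Y : Matrix (Fin m) (Fin m) ℝ) : B * (H * (G * Y * Gᵀ) * Hᵀ) * Bᵀ = B * Y * Bᵀ := by
    calc B * (H * (G * Y * Gᵀ) * Hᵀ) * Bᵀ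
        = (B * (H * G)) * Y * (B * (H * G))ᵀ := by
          simp only [transpose_mul, Matrix.mul_assoc]
      _ = B * Y * Bᵀ := by rw [hB]
  have htr (Y : Matrix (Fin m) (Fin m) ℝ) :
      trace (G * Y * Gᵀ) = ∑ i, trace (A i * Y * (A i)ᵀ) := by
    simp [G, trace, Matrix.mul_apply, Fintype.sum_prod_type]
  have hpsd {n p : Type} [Fintype n] [Fintype p] (B : Matrix n p ℝ) {Y : Matrix p p ℝ}
      (hY : Y.PosSemidef) : (B * Y * Bᵀ).PosSemidef := by
    simpa using hY.mul_mul_conjTranspose_same B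
  let S : Set (Matrix (Fin s × Fin l) (Fin s × Fin l) ℝ) :=
    {Z | Z.PosSemidef ∧ Z.trace ≤ ∑ i, b i} ∩
      {Z | ∀ i, trace (A i * (H * Z * Hᵀ) * (A i)ᵀ) ≤ b i}
  have hS : IsCompact S := by
    refine (isCompact_posSemidef_trace_le _).inter_right ?_
    rw [Set.ofPred_forall]
    exact isClosed_iInter fun i => isClosed_le (by fun_prop) continuous_const
  have hne : S.Nonempty :=
    ⟨0, ⟨PosSemidef.zero, by simpa using Finset.sum_nonneg fun i _ => hb i⟩,
      fun i => by simpa using hb i⟩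
  obtain ⟨Z, ⟨⟨hZ, -⟩, hZb⟩, hmax⟩ := hS.exists_isMaxOn hne
    (f := fun Z => trace (K * (H * Z * Hᵀ) * Kᵀ)) (by fun_prop)
  refine ⟨H * Z * Hᵀ, ⟨hpsd H hZ, hZb⟩, fun Y hY => ?_⟩
  have hmem : G * Y * Gᵀ ∈ S := by
    refine ⟨⟨hpsd G hY.1, ?_⟩, fun i => ?_⟩
    · rw [htr]
      exact Finset.sum_le_sum fun i _ => hY.2 i
    · rw [hconj _ (hA i)]
      exact hY.2 i
  have h1 := hmax hmem
  simp only [Set.mem_ofPred_eq, hconj K hK] at h1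
  exact h1

open scoped MatrixOrder Matrix.Norms.L2Operator in
/-- Any feasible point can be replaced by a feasible point of rank at most `K.rank` with the
same objective value. -/
theorem PackFeas.exists_rank_le {s l m r : ℕ}
    {A : Fin s → Matrix (Fin l) (Fin m) ℝ} (K : Matrix (Fin r) (Fin m) ℝ)
    {b : Fin s → ℝ} {X : Matrix (Fin m) (Fin m) ℝ} (hX : PackFeas A b X) :
    ∃ Y, PackFeas A b Y ∧ K * Y * Kᵀ = K * X * Kᵀ ∧ Y.rank ≤ K.rank := by
  obtain ⟨V, hV⟩ : ∃ V : Matrix (Fin m) (Fin m) ℝ, X = V * Vᵀ := by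
    obtain ⟨B, hB⟩ := CStarAlgebra.nonneg_iff_eq_star_mul_self.mp hX.1.nonneg
    exact ⟨Bᵀ, by simpa [star_eq_conjTranspose] using hB⟩
  obtain ⟨P, hPt, hPP, hKP, hrank⟩ := exists_rowSpace_projection (K * V)
  have hsq {n : Type} [Fintype n] (B : Matrix n (Fin m) ℝ) : (B * Bᵀ).PosSemidef := by
    simpa using posSemidef_self_mul_conjTranspose B
  have hY : V * P * Vᵀ = V * P * (V * P)ᵀ := by
    rw [transpose_mul, hPt, ← Matrix.mul_assoc, Matrix.mul_assoc V P P, hPP]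
  refine ⟨V * P * Vᵀ, ⟨hY ▸ hsq _, fun i => ?_⟩, ?_, ?_⟩
  · have hdiff : A i * X * (A i)ᵀ - A i * (V * P * Vᵀ) * (A i)ᵀ
        = (A i * V * (1 - P)) * (A i * V * (1 - P))ᵀ := by
      have hQ : (1 - P) * (1 - P)ᵀ = 1 - P := by
        simp [Matrix.sub_mul, Matrix.mul_sub, hPt, hPP]
      rw [transpose_mul (A i * V), ← Matrix.mul_assoc (A i * V * (1 - P)),
        Matrix.mul_assoc (A i * V), hQ, hV, transpose_mul]
      simp only [Matrix.mul_sub, Matrix.sub_mul, Matrix.mul_one, Matrix.mul_assoc]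
    have h0 := (hsq (A i * V * (1 - P))).trace_nonneg
    rw [← hdiff, trace_sub] at h0
    linarith [hX.2 i]
  · calc K * (V * P * Vᵀ) * Kᵀ = K * V * P * Vᵀ * Kᵀ := by simp only [Matrix.mul_assoc]
      _ = K * X * Kᵀ := by rw [hKP, hV, Matrix.mul_assoc K V]
  · calc (V * P * Vᵀ).rank ≤ (V * P).rank := rank_mul_le_left _ _
      _ ≤ P.rank := rank_mul_le_right _ _
      _ ≤ (K * V).rank := hrank
      _ ≤ K.rank := rank_mul_le_left _ _

/-- **Low-rank reduction theorem for semidefinite packing programs.** If `b ≥ 0` and the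
range of `Kᵀ` is contained in the range of `∑ i, A iᵀ A i`, then the packing program
maximizing `trace (Kᵀ K X)` has an optimal solution `X*` with
`rank X* ≤ rank (Kᵀ K) = rank K`. -/
theorem packingSDP_lowrank_solution {s l m r : ℕ}
    (A : Fin s → Matrix (Fin l) (Fin m) ℝ) (K : Matrix (Fin r) (Fin m) ℝ)
    (b : Fin s → ℝ) (hb : ∀ i, 0 ≤ b i)
    (hrange : ∀ y : Fin r → ℝ, ∃ u, (∑ i, (A i)ᵀ * A i) *ᵥ u = Kᵀ *ᵥ y) :
    ∃ Xstar : Matrix (Fin m) (Fin m) ℝ, PackFeas A b Xstar ∧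
      (∀ X, PackFeas A b X →
        Matrix.trace (Kᵀ * K * X) ≤ Matrix.trace (Kᵀ * K * Xstar)) ∧
      Xstar.rank ≤ (Kᵀ * K).rank ∧ (Kᵀ * K).rank = K.rank := by
  obtain ⟨X, hX, hmax⟩ := PackFeas.exists_isMax A K b hb hrange
  obtain ⟨Y, hY, hKY, hrank⟩ := hX.exists_rank_le K
  have hobj (Z : Matrix (Fin m) (Fin m) ℝ) : trace (Kᵀ * K * Z) = trace (K * Z * Kᵀ) := by
    rw [Matrix.mul_assoc, trace_mul_comm]
  refine ⟨Y, hY, fun Z hZ => ?_, by rwa [rank_transpose_mul_self], rank_transpose_mul_self K⟩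
  rw [hobj, hobj, hKY]
  exact hmax Z hZ
end

section
/- Let A_1,…,A_s be real l×m matrices, c ∈ ℝ^m with c in the range of Σ_{i=1}^s A_i^T A_i, and b ∈ ℝ^s with b_i ≥ 0 for all i. Then the supremum of c^T x over {x ∈ ℝ^m : ‖A_i x‖ ≤ √(b_i) for all i} is attained by some x*, the matrix X* := x* (x*)^T is an optimal solution of the semidefinite packing program maximizing c^T X c over {X ∈ ℝ^{m×m} symmetric : X positive semidefinite, trace(A_i X A_i^T) ≤ b_i for all i}, and the optimal value of this semidefinite program equals (c^T x*)². -/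
open Matrix BigOperators

lemma euclNorm_le_sqrt_iff {n : ℕ} (v : Fin n → ℝ) {r : ℝ} (hr : 0 ≤ r) :
    euclNorm v ≤ Real.sqrt r ↔ v ⬝ᵥ v ≤ r := by
  rw [euclNorm, Real.sqrt_le_sqrt_iff hr]
  simp [dotProduct, sq]

lemma trace_mul_vecMulVec_self_mul_transpose {l m : Type*} [Fintype l] [Fintype m]
    (A : Matrix l m ℝ) (x : m → ℝ) :
    trace (A * vecMulVec x x * Aᵀ) = (A *ᵥ x) ⬝ᵥ (A *ᵥ x) := by
  rw [mul_vecMulVec, vecMulVec_mul, trace_vecMulVec, vecMul_transpose]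

lemma dotProduct_vecMulVec_self_mulVec {m : Type*} [Fintype m] (c x : m → ℝ) :
    c ⬝ᵥ (vecMulVec x x *ᵥ c) = (c ⬝ᵥ x) ^ 2 := by
  rw [vecMulVec_mulVec, op_smul_eq_smul, dotProduct_smul, smul_eq_mul, dotProduct_comm x c, sq]

/-- Cauchy–Schwarz: the Euclidean operator norm is at most the Frobenius norm. -/
lemma mulVec_dotProduct_mulVec_le {l m : Type*} [Fintype l] [Fintype m]
    (M : Matrix l m ℝ) (y : m → ℝ) :
    (M *ᵥ y) ⬝ᵥ (M *ᵥ y) ≤ trace (M * Mᵀ) * (y ⬝ᵥ y) := by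
  simp only [trace, diag_apply, mul_apply, transpose_apply]
  rw [Finset.sum_mul]
  refine Finset.sum_le_sum fun i _ => ?_
  have h := Finset.sum_mul_sq_le_sq_mul_sq Finset.univ (M i) y
  simpa only [mulVec, dotProduct, sq] using h

open scoped MatrixOrder Matrix.Norms.L2Operator in
/-- A quadratic-form Cauchy–Schwarz inequality for positive semidefinite `X`. -/
lemma Matrix.PosSemidef.mulVec_dotProduct_mulVec_le {l m : Type*} [Fintype l] [Fintype m]
    {X : Matrix m m ℝ} (hX : X.PosSemidef) (A : Matrix l m ℝ) (c : m → ℝ) :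
    (A *ᵥ (X *ᵥ c)) ⬝ᵥ (A *ᵥ (X *ᵥ c)) ≤ trace (A * X * Aᵀ) * (c ⬝ᵥ (X *ᵥ c)) := by
  classical
  obtain ⟨B, rfl⟩ : ∃ B : Matrix m m ℝ, X = Bᵀ * B := by
    obtain ⟨B, hB⟩ := CStarAlgebra.nonneg_iff_eq_star_mul_self.mp hX.nonneg
    exact ⟨B, by rwa [star_eq_conjTranspose, conjTranspose_eq_transpose_of_trivial] at hB⟩
  have h := _root_.mulVec_dotProduct_mulVec_le (A * Bᵀ) (B *ᵥ c)
  have hc : c ⬝ᵥ ((Bᵀ * B) *ᵥ c) = (B *ᵥ c) ⬝ᵥ (B *ᵥ c) := by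
    rw [← mulVec_mulVec, dotProduct_mulVec, vecMul_transpose]
  rw [hc]
  simpa only [transpose_mul, transpose_transpose, Matrix.mul_assoc, mulVec_mulVec] using h

/-- A linear objective in the range of `∑ i, (A i)ᵀ * A i` attains its maximum over
the set cut out by the constraints `‖A i x‖ ≤ √(b i)`. -/
lemma exists_maximizer_of_mem_range {s l m : ℕ}
    (A : Fin s → Matrix (Fin l) (Fin m) ℝ) (c : Fin m → ℝ)
    (b : Fin s → ℝ) (hb : ∀ i, 0 ≤ b i)
    (hrange : ∃ u, (∑ i, (A i)ᵀ * A i) *ᵥ u = c) :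
    ∃ z : Fin m → ℝ, (∀ i, (A i *ᵥ z) ⬝ᵥ (A i *ᵥ z) ≤ b i) ∧
      ∀ x : Fin m → ℝ, (∀ i, (A i *ᵥ x) ⬝ᵥ (A i *ᵥ x) ≤ b i) → c ⬝ᵥ x ≤ c ⬝ᵥ z := by
  obtain ⟨u, rfl⟩ := hrange
  have hobj (x : Fin m → ℝ) :
      ((∑ i, (A i)ᵀ * A i) *ᵥ u) ⬝ᵥ x = ∑ i, (A i *ᵥ u) ⬝ᵥ (A i *ᵥ x) := by
    rw [sum_mulVec, sum_dotProduct]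
    refine Finset.sum_congr rfl fun i _ => ?_
    rw [← mulVec_mulVec, dotProduct_mulVec, mulVec_transpose]
  let L : (Fin m → ℝ) →ₗ[ℝ] (Fin s → Fin l → ℝ) := LinearMap.pi fun i => (A i).mulVecLin
  let K : Set (Fin s → Fin l → ℝ) := (LinearMap.range L : Set _) ∩ {y | ∀ i, y i ⬝ᵥ y i ≤ b i}
  have hclosed : IsClosed K := by
    refine (Submodule.closed_of_finiteDimensional _).inter ?_
    simp only [Set.ofPred_forall, dotProduct]
    exact isClosed_iInter fun i => isClosed_le (by fun_prop) continuous_const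
  have hbox : IsCompact (Set.univ.pi fun i : Fin s => Set.univ.pi fun _ : Fin l =>
      Set.Icc (-Real.sqrt (b i)) (Real.sqrt (b i))) :=
    isCompact_univ_pi fun i => isCompact_univ_pi fun _ => isCompact_Icc
  have hcompact : IsCompact K := by
    refine hbox.of_isClosed_subset hclosed fun y hy i _ j _ => ?_
    refine abs_le.mp (Real.abs_le_sqrt ?_)
    rw [sq]
    exact (Finset.single_le_sum (f := fun j => y i j * y i j)
      (fun j _ => mul_self_nonneg _) (Finset.mem_univ j)).trans (hy.2 i)
  have hne : K.Nonempty := ⟨0, Submodule.zero_mem _, fun i => by simpa using hb i⟩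
  obtain ⟨_, ⟨⟨z, rfl⟩, hz⟩, hmax⟩ := hcompact.exists_isMaxOn hne
    (f := fun y => ∑ i, (A i *ᵥ u) ⬝ᵥ y i) (by unfold dotProduct; fun_prop)
  refine ⟨z, hz, fun x hx => ?_⟩
  rw [hobj, hobj]
  exact hmax (show L x ∈ K from ⟨⟨x, rfl⟩, hx⟩)

/-- **Rank-one solutions of packing programs with a rank-one objective.** The SOCP
maximizing `cᵀ x` subject to `‖A i x‖ ≤ √(b i)` is attained by some `x*`, and
`X* = x* x*ᵀ` is an optimal solution of the packing SDP maximizing `cᵀ X c`, whose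
optimal value is `(cᵀ x*)²`. -/
theorem packingSDP_rankone {s l m : ℕ}
    (A : Fin s → Matrix (Fin l) (Fin m) ℝ) (c : Fin m → ℝ)
    (b : Fin s → ℝ) (hb : ∀ i, 0 ≤ b i)
    (hrange : ∃ u, (∑ i, (A i)ᵀ * A i) *ᵥ u = c) :
    ∃ xstar : Fin m → ℝ,
      (∀ i, euclNorm (A i *ᵥ xstar) ≤ Real.sqrt (b i)) ∧
      (∀ x : Fin m → ℝ, (∀ i, euclNorm (A i *ᵥ x) ≤ Real.sqrt (b i)) →
        c ⬝ᵥ x ≤ c ⬝ᵥ xstar) ∧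
      PackFeas A b (Matrix.vecMulVec xstar xstar) ∧
      (∀ X, PackFeas A b X →
        c ⬝ᵥ (X *ᵥ c) ≤ c ⬝ᵥ (Matrix.vecMulVec xstar xstar *ᵥ c)) ∧
      c ⬝ᵥ (Matrix.vecMulVec xstar xstar *ᵥ c) = (c ⬝ᵥ xstar) ^ 2 := by
  obtain ⟨z, hz, hmax⟩ := exists_maximizer_of_mem_range A c b hb hrange
  refine ⟨z, fun i => (euclNorm_le_sqrt_iff _ (hb i)).2 (hz i),
    fun x hx => hmax x fun i => (euclNorm_le_sqrt_iff _ (hb i)).1 (hx i),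
    ⟨by simpa using posSemidef_vecMulVec_self_star z, fun i => ?_⟩, fun X hX => ?_,
    dotProduct_vecMulVec_self_mulVec c z⟩
  · rw [trace_mul_vecMulVec_self_mul_transpose]
    exact hz i
  rw [dotProduct_vecMulVec_self_mulVec]
  set t := c ⬝ᵥ (X *ᵥ c) with ht
  rcases le_or_gt t 0 with h0 | h0
  · exact h0.trans (sq_nonneg _)
  have hsq : Real.sqrt t * Real.sqrt t = t := Real.mul_self_sqrt h0.le
  have hs : 0 < Real.sqrt t := Real.sqrt_pos.2 h0
  have hle := hmax ((Real.sqrt t)⁻¹ • (X *ᵥ c)) fun i => by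
    have h := hX.1.mulVec_dotProduct_mulVec_le (A i) c
    rw [mulVec_smul, smul_dotProduct, dotProduct_smul, smul_eq_mul, smul_eq_mul, ← mul_assoc,
      ← mul_inv, hsq, inv_mul_le_iff₀ h0, mul_comm t]
    exact h.trans (mul_le_mul_of_nonneg_right (hX.2 i) h0.le)
  rw [dotProduct_smul, ← ht, smul_eq_mul, inv_mul_le_iff₀ hs] at hle
  have : Real.sqrt t ≤ c ⬝ᵥ z := le_of_mul_le_mul_left (hsq.le.trans hle) hs
  nlinarith
end

section
/- Let A_1,…,A_s be real l×m matrices and let K be a real m×r matrix of rank r whose range is contained in the range of Σ_{i=1}^s A_i^T A_i. Let 𝒰 := {U ∈ ℝ^{m×r} : K^T U = I_r}, which is nonempty. Then the supremum over designs w (w ∈ ℝ^s, w ≥ 0, Σ_i w_i = 1) of inf{ Σ_{i=1}^s w_i ‖A_i U‖_F² : U ∈ 𝒰 } equals inf{ max_{i ∈ {1,…,s}} ‖A_i U‖_F² : U ∈ 𝒰 }, and the supremum over designs is attained by some design w* (such a w* is a formally T-optimal design for K^T θ). Here Σ_i w_i ‖A_i U‖_F² = trace(U^T M(w) U). -/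
open Matrix BigOperators

theorem frobNorm_sq {n p : ℕ} (B : Matrix (Fin n) (Fin p) ℝ) :
    frobNorm B ^ 2 = ∑ i, ∑ j, B i j ^ 2 :=
  Real.sq_sqrt (Finset.sum_nonneg fun _ _ => Finset.sum_nonneg fun _ _ => sq_nonneg _)

theorem frobNorm_sq_eq_trace {n p : ℕ} (B : Matrix (Fin n) (Fin p) ℝ) :
    frobNorm B ^ 2 = Matrix.trace (Bᵀ * B) := by
  rw [frobNorm_sq, Finset.sum_comm]
  simp [Matrix.trace, Matrix.mul_apply, sq]

theorem convexOn_frobNorm_sq_mul {n m p : ℕ} (A : Matrix (Fin n) (Fin m) ℝ) :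
    ConvexOn ℝ Set.univ fun U : Matrix (Fin m) (Fin p) ℝ => frobNorm (A * U) ^ 2 := by
  refine ⟨convex_univ, fun U _ V _ a b ha hb hab => ?_⟩
  simp only [frobNorm_sq, Matrix.mul_add, Matrix.mul_smul, smul_eq_mul, Finset.mul_sum,
    ← Finset.sum_add_distrib]
  refine Finset.sum_le_sum fun i _ => Finset.sum_le_sum fun j _ => ?_
  simpa using (even_two.convexOn_pow (𝕜 := ℝ)).2 (Set.mem_univ ((A * U) i j))
    (Set.mem_univ ((A * V) i j)) ha hb hab

theorem exists_mul_eq_one_of_rank_eq {m r : ℕ} (K : Matrix (Fin m) (Fin r) ℝ)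
    (hK : K.rank = r) : ∃ U : Matrix (Fin m) (Fin r) ℝ, Kᵀ * U = 1 := by
  rw [← Matrix.mulVec_surjective_iff_exists_right_inverse]
  have h : LinearMap.range Kᵀ.mulVecLin = ⊤ := by
    apply Submodule.eq_top_of_finrank_eq
    change Kᵀ.rank = _
    rw [Matrix.rank_transpose, hK, Module.finrank_fin_fun]
  exact LinearMap.range_eq_top.1 h

/-- Finite minimax: a lower bound for the maximum of finitely many convex functions is a lower
bound for one of their convex combinations. -/
theorem exists_stdSimplex_forall_le_sum {ι E : Type*} [Fintype ι] [AddCommGroup E] [Module ℝ E]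
    {S : Set E} (hS : S.Nonempty) {f : ι → E → ℝ} (hf : ∀ i, ConvexOn ℝ S (f i)) {v : ℝ}
    (hv : ∀ x ∈ S, ∃ i, v ≤ f i x) :
    ∃ w ∈ stdSimplex ℝ ι, ∀ x ∈ S, v ≤ ∑ i, w i * f i x := by
  classical
  obtain ⟨x₀, hx₀⟩ := hS
  set C : Set (ι → ℝ) := {y | ∃ x ∈ S, ∀ i, f i x < y i} with hC
  have hCconv : Convex ℝ C := by
    rintro y ⟨x, hx, hxy⟩ z ⟨x', hx', hxz⟩ a b ha hb hab
    refine ⟨a • x + b • x', (hf (hv x₀ hx₀).choose).1 hx hx' ha hb hab, fun i => ?_⟩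
    refine ((hf i).2 hx hx' ha hb hab).trans_lt ?_
    have h1 := hxy i
    have h2 := hxz i
    simp only [smul_eq_mul, Pi.add_apply, Pi.smul_apply]
    rcases ha.eq_or_lt with rfl | ha'
    · obtain rfl : b = 1 := by linarith
      linarith
    · nlinarith [mul_lt_mul_of_pos_left h1 ha', mul_le_mul_of_nonneg_left h2.le hb]
  have hCopen : IsOpen C := by
    have : C = ⋃ x ∈ S, Set.univ.pi fun i => Set.Ioi (f i x) := by
      ext y; simp [hC]
    rw [this]
    exact isOpen_biUnion fun x _ => isOpen_set_pi Set.finite_univ fun i _ => isOpen_Ioi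
  have hvC : (fun _ => v) ∉ C := by
    rintro ⟨x, hx, hlt⟩
    obtain ⟨i, hi⟩ := hv x hx
    exact (hlt i).not_ge hi
  obtain ⟨g, hg⟩ := geometric_hahn_banach_point_open hCconv hCopen hvC
  set c : ι → ℝ := fun i => g (Pi.single i 1) with hc
  have hgc (y : ι → ℝ) : g y = ∑ i, c i * y i := by
    conv_lhs => rw [pi_eq_sum_univ' y]
    simp [map_sum, hc, mul_comm, Pi.single]
  have hgt {x : E} (hx : x ∈ S) {t : ι → ℝ} (ht : ∀ i, 0 < t i) :
      (∑ i, c i) * v < ∑ i, c i * f i x + ∑ i, c i * t i := by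
    have := hg (fun i => f i x + t i) ⟨x, hx, fun i => by linarith [ht i]⟩
    simpa [hgc, mul_add, Finset.sum_add_distrib, Finset.sum_mul] using this
  have hc0 (i : ι) : 0 ≤ c i := by
    by_contra! hi
    set D := ∑ j, c j * f j x₀ + ∑ j, c j - (∑ j, c j) * v
    have h := hgt hx₀ (t := fun j => 1 + if j = i then |D| / (-c i) else 0) fun j => by
      have : 0 ≤ |D| / (-c i) := div_nonneg (abs_nonneg _) (by linarith)
      split_ifs <;> linarith
    simp only [mul_add, mul_one, Finset.sum_add_distrib, mul_ite, mul_zero,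
      Finset.sum_ite_eq', Finset.mem_univ, if_true] at h
    have h2 : c i * (|D| / (-c i)) = -|D| := by
      rw [div_neg, mul_neg, mul_div_cancel₀ _ hi.ne]
    rw [h2] at h
    have := le_abs_self D
    simp only [D] at this h
    linarith
  have hcpos : 0 < ∑ i, c i := by
    refine (Finset.sum_nonneg fun i _ => hc0 i).lt_of_ne fun h => ?_
    have hz : ∀ i, c i = 0 := fun i =>
      (Finset.sum_eq_zero_iff_of_nonneg fun i _ => hc0 i).1 h.symm i (Finset.mem_univ i)
    simpa [hz] using hgt hx₀ (t := fun _ => 1) fun _ => one_pos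
  refine ⟨fun i => c i / ∑ j, c j, ⟨fun i => div_nonneg (hc0 i) hcpos.le, ?_⟩, fun x hx => ?_⟩
  · rw [← Finset.sum_div, div_self hcpos.ne']
  · refine le_of_forall_pos_le_add fun ε hε => ?_
    have h := hgt hx (t := fun _ => ε) fun _ => hε
    simp only [div_mul_eq_mul_div, ← Finset.sum_div]
    rw [← Finset.sum_mul] at h
    rw [← sub_le_iff_le_add, le_div_iff₀ hcpos]
    linarith

theorem sum_mul_frobNorm_sq_le_iSup {s l m r : ℕ} (A : Fin s → Matrix (Fin l) (Fin m) ℝ)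
    {w : Fin s → ℝ} (hw : IsDesign w) (U : Matrix (Fin m) (Fin r) ℝ) :
    ∑ i, w i * frobNorm (A i * U) ^ 2 ≤ ⨆ i, frobNorm (A i * U) ^ 2 := by
  calc ∑ i, w i * frobNorm (A i * U) ^ 2
      ≤ ∑ i, w i * ⨆ i, frobNorm (A i * U) ^ 2 :=
        Finset.sum_le_sum fun i _ => mul_le_mul_of_nonneg_left
          (le_ciSup (Set.finite_range fun i => frobNorm (A i * U) ^ 2).bddAbove i) (hw.1 i)
    _ = _ := by rw [← Finset.sum_mul, hw.2, one_mul]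

/-- **Formal `T`-optimality as a saddle point / SOCP.** For `K` of rank `r` with range
contained in the range of `∑ i, A iᵀ A i`, the set `𝒰 = {U : Kᵀ U = I}` is nonempty,
`∑ i, w i ‖A i U‖_F² = trace (Uᵀ M(w) U)`, and the supremum over designs `w` of
`inf {∑ i, w i ‖A i U‖_F² : U ∈ 𝒰}` is attained by some (formally `T`-optimal) design `w*`
and equals `inf {max_i ‖A i U‖_F² : U ∈ 𝒰}`. -/
theorem tOptimal_SOCP {s l m r : ℕ} (hs : 0 < s)
    (A : Fin s → Matrix (Fin l) (Fin m) ℝ)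
    (K : Matrix (Fin m) (Fin r) ℝ) (hK : K.rank = r)
    (hrange : ∀ x : Fin r → ℝ, ∃ u, (∑ i, (A i)ᵀ * A i) *ᵥ u = K *ᵥ x) :
    (∃ U : Matrix (Fin m) (Fin r) ℝ, Kᵀ * U = 1) ∧
    (∀ (w : Fin s → ℝ) (U : Matrix (Fin m) (Fin r) ℝ),
      ∑ i, w i * frobNorm (A i * U) ^ 2 = Matrix.trace (Uᵀ * infoMat A w * U)) ∧
    (∃ wstar : Fin s → ℝ, IsDesign wstar ∧
      (∀ w : Fin s → ℝ, IsDesign w →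
        sInf {x : ℝ | ∃ U : Matrix (Fin m) (Fin r) ℝ, Kᵀ * U = 1 ∧
            x = ∑ i, w i * frobNorm (A i * U) ^ 2} ≤
        sInf {x : ℝ | ∃ U : Matrix (Fin m) (Fin r) ℝ, Kᵀ * U = 1 ∧
            x = ∑ i, wstar i * frobNorm (A i * U) ^ 2}) ∧
      sInf {x : ℝ | ∃ U : Matrix (Fin m) (Fin r) ℝ, Kᵀ * U = 1 ∧
          x = ∑ i, wstar i * frobNorm (A i * U) ^ 2} =
        sInf {x : ℝ | ∃ U : Matrix (Fin m) (Fin r) ℝ, Kᵀ * U = 1 ∧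
          x = ⨆ i : Fin s, frobNorm (A i * U) ^ 2}) := by
  have hne := exists_mul_eq_one_of_rank_eq K hK
  have : Nonempty (Fin s) := ⟨⟨0, hs⟩⟩
  refine ⟨hne, fun w U => ?_, ?_⟩
  · simp only [frobNorm_sq_eq_trace, infoMat, Matrix.mul_sum, Matrix.sum_mul, Matrix.trace_sum,
      Matrix.mul_smul, Matrix.smul_mul, Matrix.trace_smul, smul_eq_mul, Matrix.transpose_mul,
      Matrix.mul_assoc]
  set S : Set (Matrix (Fin m) (Fin r) ℝ) := {U | Kᵀ * U = 1}
  have hSconv : Convex ℝ S := fun U hU V hV a b _ _ hab => by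
    change Kᵀ * (a • U + b • V) = 1
    rw [Matrix.mul_add, Matrix.mul_smul, Matrix.mul_smul, show Kᵀ * U = 1 from hU,
      show Kᵀ * V = 1 from hV, ← add_smul, hab, one_smul]
  set v := sInf {x : ℝ | ∃ U : Matrix (Fin m) (Fin r) ℝ, Kᵀ * U = 1 ∧
    x = ⨆ i : Fin s, frobNorm (A i * U) ^ 2} with hv
  have hle (w : Fin s → ℝ) (hw : IsDesign w) :
      sInf {x : ℝ | ∃ U : Matrix (Fin m) (Fin r) ℝ, Kᵀ * U = 1 ∧
        x = ∑ i, w i * frobNorm (A i * U) ^ 2} ≤ v := by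
    refine le_csInf (hne.imp' (fun U => ⨆ i, frobNorm (A i * U) ^ 2) fun U hU => ⟨U, hU, rfl⟩) ?_
    rintro _ ⟨U, hU, rfl⟩
    refine csInf_le_of_le ⟨0, ?_⟩ ⟨U, hU, rfl⟩ (sum_mul_frobNorm_sq_le_iSup A hw U)
    rintro _ ⟨V, -, rfl⟩
    exact Finset.sum_nonneg fun i _ => mul_nonneg (hw.1 i) (sq_nonneg _)
  obtain ⟨w, hw, hvw⟩ := exists_stdSimplex_forall_le_sum (S := S) hne
    (f := fun i U => frobNorm (A i * U) ^ 2) (v := v)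
    (fun i => (convexOn_frobNorm_sq_mul (A i)).subset (Set.subset_univ _) hSconv) fun U hU => by
      obtain ⟨i, hi⟩ := exists_eq_ciSup_of_finite (f := fun i => frobNorm (A i * U) ^ 2)
      refine ⟨i, hi ▸ csInf_le ⟨0, ?_⟩ ⟨U, hU, rfl⟩⟩
      rintro _ ⟨V, -, rfl⟩
      exact Real.iSup_nonneg fun i => sq_nonneg _
  have hge : v ≤ sInf {x : ℝ | ∃ U : Matrix (Fin m) (Fin r) ℝ, Kᵀ * U = 1 ∧
      x = ∑ i, w i * frobNorm (A i * U) ^ 2} := by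
    refine le_csInf (hne.imp' (fun U => ∑ i, w i * frobNorm (A i * U) ^ 2)
      fun U hU => ⟨U, hU, rfl⟩) ?_
    rintro _ ⟨U, hU, rfl⟩
    exact hvw U hU
  exact ⟨w, hw, fun w' hw' => (hle w' hw').trans hge, (hle w hw).antisymm hge⟩
end

section
/- Assume each c_k is nonzero and lies in the range of Σ_{i=1}^s A_{(k),i}^T A_{(k),i}. Then the following three quantities are equal: (1) the minimum over feasible designs w of S_β(w); (2) the infimum of Σ_{k=1}^r (−β_k log τ_k) over all (τ, w) with τ ∈ ℝ^r, τ_k > 0, w a design (w ≥ 0, Σ_i w_i = 1), such that M_{(k)}(w) − τ_k c_k c_k^T is positive semidefinite for every k; (3) the supremum of Σ_{k=1}^r β_k log(c_k^T Z_k c_k / β_k) over all r-tuples (Z_1,…,Z_r) of symmetric positive semidefinite m×m real matrices with c_k^T Z_k c_k > 0 for all k and Σ_{k=1}^r trace(A_{(k),i} Z_k A_{(k),i}^T) ≤ 1 for every i ∈ {1,…,s}. Moreover, any (τ, w) attaining the infimum in (2) has w minimizing S_β over feasible designs. -/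
open Matrix BigOperators

/-- Information matrix of the `k`-th model: `M_{(k)}(w) = ∑ i, w i • A k iᵀ A k i`. -/
noncomputable def infoMatK {s l m r : ℕ}
    (A : Fin r → Fin s → Matrix (Fin l) (Fin m) ℝ) (k : Fin r) (w : Fin s → ℝ) :
    Matrix (Fin m) (Fin m) ℝ :=
  ∑ i, w i • ((A k i)ᵀ * A k i)

/-- `w` is feasible when every `c k` lies in the range of `M_{(k)}(w)`. -/
def FeasibleS {s l m r : ℕ} (A : Fin r → Fin s → Matrix (Fin l) (Fin m) ℝ)
    (c : Fin r → Fin m → ℝ) (w : Fin s → ℝ) : Prop :=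
  ∀ k, ∃ u, infoMatK A k w *ᵥ u = c k

/-- The set of values of the `S_β`-criterion `∑ k, β k * log (c k ⬝ᵥ u k)` of `w`,
over all witnesses `u k` with `M_{(k)}(w) (u k) = c k` (it is a singleton when `w` is
feasible, since the value does not depend on the witnesses). -/
def SVal {s l m r : ℕ} (A : Fin r → Fin s → Matrix (Fin l) (Fin m) ℝ)
    (c : Fin r → Fin m → ℝ) (β : Fin r → ℝ) (w : Fin s → ℝ) : Set ℝ :=
  {x | ∃ u : Fin r → Fin m → ℝ, (∀ k, infoMatK A k w *ᵥ u k = c k) ∧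
    x = ∑ k, β k * Real.log (c k ⬝ᵥ u k)}

/-- Values of the primal semidefinite program `(P_β-SDP)`. -/
def PβSDPVals {s l m r : ℕ} (A : Fin r → Fin s → Matrix (Fin l) (Fin m) ℝ)
    (c : Fin r → Fin m → ℝ) (β : Fin r → ℝ) : Set ℝ :=
  {x | ∃ (τ : Fin r → ℝ) (w : Fin s → ℝ),
    (∀ k, 0 < τ k) ∧ IsDesign w ∧
    (∀ k, (infoMatK A k w - τ k • Matrix.vecMulVec (c k) (c k)).PosSemidef) ∧
    x = ∑ k, -(β k * Real.log (τ k))}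

/-- Values of the dual semidefinite program `(D_β-SDP)`. -/
def DβSDPVals {s l m r : ℕ} (A : Fin r → Fin s → Matrix (Fin l) (Fin m) ℝ)
    (c : Fin r → Fin m → ℝ) (β : Fin r → ℝ) : Set ℝ :=
  {x | ∃ Z : Fin r → Matrix (Fin m) (Fin m) ℝ,
    (∀ k, (Z k).PosSemidef) ∧
    (∀ k, 0 < c k ⬝ᵥ (Z k *ᵥ c k)) ∧
    (∀ i, ∑ k, Matrix.trace (A k i * Z k * (A k i)ᵀ) ≤ 1) ∧
    x = ∑ k, β k * Real.log ((c k ⬝ᵥ (Z k *ᵥ c k)) / β k)}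

theorem sq_dotProduct_mulVec_le {n : Type*} [Fintype n] {M : Matrix n n ℝ} (hM : M.PosSemidef)
    (x y : n → ℝ) : (x ⬝ᵥ M *ᵥ y) ^ 2 ≤ (x ⬝ᵥ M *ᵥ x) * (y ⬝ᵥ M *ᵥ y) := by
  have hsymm : y ⬝ᵥ M *ᵥ x = x ⬝ᵥ M *ᵥ y := by
    have hT : Mᵀ = M := by simpa using hM.isHermitian.eq
    rw [dotProduct_mulVec, ← mulVec_transpose, hT, dotProduct_comm]
  have h := discrim_le_zero (a := y ⬝ᵥ M *ᵥ y) (b := 2 * (x ⬝ᵥ M *ᵥ y)) (c := x ⬝ᵥ M *ᵥ x)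
    fun t => by
      have := hM.dotProduct_mulVec_nonneg (x + t • y)
      simp only [star_trivial, mulVec_add, mulVec_smul, dotProduct_add, add_dotProduct,
        smul_dotProduct, dotProduct_smul, smul_eq_mul, hsymm] at this
      linarith
  rw [discrim] at h
  nlinarith

theorem exists_mulVec_eq_of_ker {n : Type*} [Fintype n] {M : Matrix n n ℝ}
    (hM : M.IsHermitian) {c : n → ℝ} (hker : ∀ x, M *ᵥ x = 0 → x ⬝ᵥ c = 0) :
    ∃ u, M *ᵥ u = c := by
  classical
  by_contra hne
  have hT : Mᵀ = M := by simpa using hM.eq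
  have hmem : c ∉ LinearMap.range M.mulVecLin := by
    rintro ⟨u, hu⟩
    exact hne ⟨u, hu⟩
  obtain ⟨f, hfc, hf⟩ := Submodule.exists_le_ker_of_notMem hmem
  have hfx : ∀ v, f v = (fun i => f (Pi.single i 1)) ⬝ᵥ v := fun v => by
    rw [LinearMap.pi_apply_eq_sum_univ f v, dotProduct]
    exact Finset.sum_congr rfl fun i _ => by
      rw [smul_eq_mul, mul_comm]
      congr 2
      ext j
      simp [Pi.single_apply, eq_comm]
  refine hfc ?_
  rw [hfx]
  refine hker _ (dotProduct_eq_zero _ fun y => ?_)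
  have hy : f (M *ᵥ y) = 0 := hf ⟨y, rfl⟩
  rw [hfx, dotProduct_mulVec, ← mulVec_transpose, hT] at hy
  exact hy

open scoped MatrixOrder in
theorem trace_mul_nonneg_of_posSemidef {n : Type*} [Fintype n] {P Z : Matrix n n ℝ}
    (hP : P.PosSemidef) (hZ : Z.PosSemidef) : 0 ≤ (P * Z).trace := by
  classical
  obtain ⟨B, rfl⟩ := CStarAlgebra.nonneg_iff_eq_star_mul_self.mp hZ.nonneg
  rw [star_eq_conjTranspose]
  rw [← Matrix.mul_assoc, Matrix.trace_mul_comm, ← Matrix.mul_assoc]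
  exact (hP.mul_mul_conjTranspose_same B).trace_nonneg

theorem dotProduct_pos_of_mulVec_eq {n : Type*} [Fintype n] {M : Matrix n n ℝ}
    (hM : M.PosSemidef) {c u : n → ℝ} (hc : c ≠ 0) (hu : M *ᵥ u = c) : 0 < c ⬝ᵥ u := by
  have h0 : 0 ≤ u ⬝ᵥ M *ᵥ u := hM.dotProduct_mulVec_nonneg u
  rw [dotProduct_comm, ← hu]
  refine lt_of_le_of_ne h0 fun h => hc ?_
  have := sq_dotProduct_mulVec_le hM c u
  rw [← h, mul_zero, hu] at this
  exact dotProduct_self_eq_zero.mp (by nlinarith [sq_nonneg (c ⬝ᵥ c)])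

theorem isHermitian_sub_smul_vecMulVec {n : Type*} {M : Matrix n n ℝ}
    (hM : M.IsHermitian) (c : n → ℝ) (τ : ℝ) : (M - τ • vecMulVec c c).IsHermitian := by
  refine hM.sub ?_
  ext i j
  simp [vecMulVec_apply, mul_comm]

theorem dotProduct_sub_smul_vecMulVec_mulVec {n : Type*} [Fintype n] (M : Matrix n n ℝ)
    (c x : n → ℝ) (τ : ℝ) :
    x ⬝ᵥ (M - τ • vecMulVec c c) *ᵥ x = x ⬝ᵥ M *ᵥ x - τ * (c ⬝ᵥ x) ^ 2 := by
  rw [sub_mulVec, smul_mulVec, vecMulVec_mulVec, dotProduct_sub]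
  simp only [dotProduct_smul, dotProduct_comm x c, op_smul_eq_smul, smul_eq_mul]
  ring

theorem posSemidef_sub_inv_smul_vecMulVec {n : Type*} [Fintype n] {M : Matrix n n ℝ}
    (hM : M.PosSemidef) {c u : n → ℝ} (hc : c ≠ 0) (hu : M *ᵥ u = c) :
    (M - (c ⬝ᵥ u)⁻¹ • vecMulVec c c).PosSemidef := by
  refine .of_dotProduct_mulVec_nonneg (isHermitian_sub_smul_vecMulVec hM.isHermitian c _)
    fun x => ?_
  have hpos := dotProduct_pos_of_mulVec_eq hM hc hu
  have h := sq_dotProduct_mulVec_le hM x u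
  rw [hu, dotProduct_comm u c, dotProduct_comm x c] at h
  rw [star_trivial, dotProduct_sub_smul_vecMulVec_mulVec, sub_nonneg, inv_mul_le_iff₀ hpos]
  linarith

theorem exists_mulVec_eq_of_posSemidef_sub {n : Type*} [Fintype n] {M : Matrix n n ℝ}
    (hM : M.IsHermitian) {c : n → ℝ} {τ : ℝ} (hτ : 0 < τ)
    (h : (M - τ • vecMulVec c c).PosSemidef) : ∃ u, M *ᵥ u = c := by
  refine exists_mulVec_eq_of_ker hM fun x hx => ?_
  have h0 := h.dotProduct_mulVec_nonneg x
  rw [star_trivial, dotProduct_sub_smul_vecMulVec_mulVec, hx, dotProduct_zero] at h0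
  rw [dotProduct_comm]
  have : (c ⬝ᵥ x) ^ 2 ≤ 0 := by
    by_contra! hlt
    nlinarith [mul_pos hτ hlt]
  exact pow_eq_zero_iff two_ne_zero |>.mp (le_antisymm this (sq_nonneg _))

theorem mul_dotProduct_le_one_of_posSemidef_sub {n : Type*} [Fintype n] {M : Matrix n n ℝ}
    {c u : n → ℝ} {τ : ℝ} (h : (M - τ • vecMulVec c c).PosSemidef) (hu : M *ᵥ u = c)
    (hpos : 0 < c ⬝ᵥ u) : τ * (c ⬝ᵥ u) ≤ 1 := by
  have h0 := h.dotProduct_mulVec_nonneg u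
  rw [star_trivial, dotProduct_sub_smul_vecMulVec_mulVec, hu, dotProduct_comm u c] at h0
  by_contra! hlt
  nlinarith [mul_lt_mul_of_pos_right hlt hpos]

section InformationMatrix

variable {s l m r : ℕ} (A : Fin r → Fin s → Matrix (Fin l) (Fin m) ℝ)

theorem infoMatK_posSemidef (k : Fin r) {w : Fin s → ℝ} (hw : ∀ i, 0 ≤ w i) :
    (infoMatK A k w).PosSemidef :=
  posSemidef_sum _ fun i _ =>
    (by simpa using posSemidef_conjTranspose_mul_self (A k i) :
      ((A k i)ᵀ * A k i).PosSemidef).smul (hw i)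

theorem trace_infoMatK_mul (k : Fin r) (w : Fin s → ℝ) (Z : Matrix (Fin m) (Fin m) ℝ) :
    (infoMatK A k w * Z).trace = ∑ i, w i * (A k i * Z * (A k i)ᵀ).trace := by
  simp only [infoMatK, Finset.sum_mul, trace_sum, smul_mul_assoc, trace_smul, smul_eq_mul]
  refine Finset.sum_congr rfl fun i _ => ?_
  rw [Matrix.mul_assoc, Matrix.trace_mul_comm]

variable {A} {c : Fin r → Fin m → ℝ} {β : Fin r → ℝ}

theorem dβSDPVals_le_pβSDPVals (hβ : ∀ k, 0 < β k) (hβ1 : ∑ k, β k = 1) {x y : ℝ}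
    (hx : x ∈ DβSDPVals A c β) (hy : y ∈ PβSDPVals A c β) : x ≤ y := by
  obtain ⟨Z, hZ, hcZ, htr, rfl⟩ := hx
  obtain ⟨τ, w, hτ, hw, hM, rfl⟩ := hy
  have hk : ∀ k, τ k * (c k ⬝ᵥ Z k *ᵥ c k) ≤ (infoMatK A k w * Z k).trace := fun k => by
    have h := trace_mul_nonneg_of_posSemidef (hM k) (hZ k)
    rw [sub_mul, trace_sub, smul_mul_assoc, trace_smul, vecMulVec_mul, trace_vecMulVec,
      dotProduct_comm, ← dotProduct_mulVec, smul_eq_mul] at h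
    linarith
  have hsum : ∑ k, τ k * (c k ⬝ᵥ Z k *ᵥ c k) ≤ 1 := by
    refine (Finset.sum_le_sum fun k _ => hk k).trans ?_
    simp only [trace_infoMatK_mul]
    rw [Finset.sum_comm]
    simp only [← Finset.mul_sum]
    refine (Finset.sum_le_sum fun i _ => mul_le_of_le_one_right (hw.1 i) (htr i)).trans hw.2.le
  rw [← sub_nonpos, ← Finset.sum_sub_distrib]
  calc ∑ k, (β k * Real.log ((c k ⬝ᵥ Z k *ᵥ c k) / β k) - -(β k * Real.log (τ k)))
      ≤ ∑ k, (τ k * (c k ⬝ᵥ Z k *ᵥ c k) - β k) := Finset.sum_le_sum fun k _ => by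
        have hd := div_pos (hcZ k) (hβ k)
        have := mul_le_mul_of_nonneg_left
          (Real.log_le_sub_one_of_pos (mul_pos hd (hτ k))) (hβ k).le
        rw [Real.log_mul hd.ne' (hτ k).ne', mul_add] at this
        have e : β k * ((c k ⬝ᵥ Z k *ᵥ c k) / β k * τ k - 1)
            = τ k * (c k ⬝ᵥ Z k *ᵥ c k) - β k := by
          field_simp [(hβ k).ne']
        linarith
    _ ≤ 0 := by rw [Finset.sum_sub_distrib]; linarith

theorem sVal_subset_pβSDPVals (hc : ∀ k, c k ≠ 0) {w : Fin s → ℝ} (hw : IsDesign w) :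
    SVal A c β w ⊆ PβSDPVals A c β := by
  rintro _ ⟨u, hu, rfl⟩
  have hM := fun k => infoMatK_posSemidef A k hw.1
  refine ⟨fun k => (c k ⬝ᵥ u k)⁻¹, w,
    fun k => inv_pos.mpr (dotProduct_pos_of_mulVec_eq (hM k) (hc k) (hu k)), hw,
    fun k => posSemidef_sub_inv_smul_vecMulVec (hM k) (hc k) (hu k), ?_⟩
  simp

theorem feasibleS_of_posSemidef_sub {τ : Fin r → ℝ} {w : Fin s → ℝ} (hτ : ∀ k, 0 < τ k)
    (hw : IsDesign w)
    (hM : ∀ k, (infoMatK A k w - τ k • vecMulVec (c k) (c k)).PosSemidef) :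
    FeasibleS A c w := fun k =>
  exists_mulVec_eq_of_posSemidef_sub (infoMatK_posSemidef A k hw.1).isHermitian (hτ k) (hM k)

theorem le_of_mem_sVal (hβ : ∀ k, 0 < β k) (hc : ∀ k, c k ≠ 0) {τ : Fin r → ℝ} {w : Fin s → ℝ}
    (hτ : ∀ k, 0 < τ k) (hw : IsDesign w)
    (hM : ∀ k, (infoMatK A k w - τ k • vecMulVec (c k) (c k)).PosSemidef) {x : ℝ}
    (hx : x ∈ SVal A c β w) : x ≤ ∑ k, -(β k * Real.log (τ k)) := by
  obtain ⟨u, hu, rfl⟩ := hx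
  refine Finset.sum_le_sum fun k _ => ?_
  have hpos := dotProduct_pos_of_mulVec_eq (infoMatK_posSemidef A k hw.1) (hc k) (hu k)
  have h := Real.log_nonpos (mul_pos (hτ k) hpos).le
    (mul_dotProduct_le_one_of_posSemidef_sub (hM k) (hu k) hpos)
  rw [Real.log_mul (hτ k).ne' hpos.ne'] at h
  nlinarith [hβ k]

theorem sum_log_mem_dβSDPVals (hβ : ∀ k, 0 < β k) {u : Fin r → Fin m → ℝ}
    (hpos : ∀ k, 0 < c k ⬝ᵥ u k)
    (hu : ∀ i, ∑ k, β k * ((A k i *ᵥ u k ⬝ᵥ A k i *ᵥ u k) / (c k ⬝ᵥ u k)) ≤ 1) :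
    ∑ k, β k * Real.log (c k ⬝ᵥ u k) ∈ DβSDPVals A c β := by
  have hval : ∀ k, c k ⬝ᵥ ((β k / (c k ⬝ᵥ u k)) • vecMulVec (u k) (u k)) *ᵥ c k
      = β k * (c k ⬝ᵥ u k) := fun k => by
    rw [smul_mulVec, vecMulVec_mulVec]
    simp only [dotProduct_smul, dotProduct_comm (u k) (c k), op_smul_eq_smul, smul_eq_mul]
    field_simp [(hpos k).ne']
  refine ⟨fun k => (β k / (c k ⬝ᵥ u k)) • vecMulVec (u k) (u k), fun k => ?_, fun k => ?_,
    fun i => ?_, Finset.sum_congr rfl fun k _ => ?_⟩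
  · exact (by simpa using posSemidef_vecMulVec_self_star (u k) :
      (vecMulVec (u k) (u k)).PosSemidef).smul (div_pos (hβ k) (hpos k)).le
  · rw [hval]
    exact mul_pos (hβ k) (hpos k)
  · refine le_of_eq_of_le (Finset.sum_congr rfl fun k _ => ?_) (hu i)
    beta_reduce
    rw [Matrix.mul_smul, Matrix.smul_mul, trace_smul, mul_vecMulVec, vecMulVec_mul,
      vecMul_transpose, trace_vecMulVec, smul_eq_mul]
    ring
  · rw [hval, mul_div_cancel_left₀ _ (hβ k).ne']

end InformationMatrix

/-- First-order optimality conditions at a minimizer of the criterion, when every design has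
positive definite information matrices. -/
theorem exists_isDesign_sum_le_one {s r : ℕ} {n : Type*} [Fintype n] [Nonempty (Fin s)]
    {N : Fin r → Fin s → Matrix n n ℝ} {c : Fin r → n → ℝ} {β : Fin r → ℝ}
    (hβ : ∀ k, 0 < β k) (hβ1 : ∑ k, β k = 1) (hc : ∀ k, c k ≠ 0)
    (hN : ∀ k w, IsDesign w → (∑ i, w i • N k i).PosDef) :
    ∃ (w : Fin s → ℝ) (u : Fin r → n → ℝ), IsDesign w ∧
      (∀ k, (∑ i, w i • N k i) *ᵥ u k = c k) ∧
      ∀ i, ∑ k, β k * ((u k ⬝ᵥ N k i *ᵥ u k) / (c k ⬝ᵥ u k)) ≤ 1 := by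
  classical
  set G : Fin r → (Fin s → ℝ) → Matrix n n ℝ := fun k w => ∑ i, w i • N k i with hG
  set V : Fin r → (Fin s → ℝ) → n → ℝ := fun k w => (G k w)⁻¹ *ᵥ c k with hVdef
  have hdet : ∀ k w, IsDesign w → IsUnit (G k w).det := fun k w hw =>
    (isUnit_iff_isUnit_det _).mp (hN k w hw).isUnit
  have hV : ∀ k w, IsDesign w → G k w *ᵥ V k w = c k := fun k w hw => by
    rw [hVdef, mulVec_mulVec, mul_nonsing_inv _ (hdet k w hw), one_mulVec]
  have hpos : ∀ k w, IsDesign w → 0 < c k ⬝ᵥ V k w := fun k w hw =>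
    dotProduct_pos_of_mulVec_eq (hN k w hw).posSemidef (hc k) (hV k w hw)
  have hVcont : ∀ k, ContinuousOn (V k) (stdSimplex ℝ (Fin s)) := fun k w hw => by
    have hGc : Continuous (G k) := by fun_prop
    have hinv : ContinuousAt (fun w => (G k w)⁻¹) w := by
      refine ContinuousAt.comp (f := G k) (g := Inv.inv)
        (continuousAt_matrix_inv _ ?_) hGc.continuousAt
      rw [Ring.inverse_eq_inv']
      exact continuousAt_inv₀ (hdet k w hw).ne_zero
    have hmul : Continuous fun M : Matrix n n ℝ => M *ᵥ c k :=
      continuous_id.matrix_mulVec continuous_const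
    exact (hmul.continuousAt.comp hinv).continuousWithinAt
  have hdot : ∀ k, ContinuousOn (fun w => c k ⬝ᵥ V k w) (stdSimplex ℝ (Fin s)) := fun k =>
    (show Continuous fun v : n → ℝ => c k ⬝ᵥ v from
      continuous_const.dotProduct continuous_id).comp_continuousOn (hVcont k)
  have hF : ContinuousOn (fun w => ∑ k, β k * Real.log (c k ⬝ᵥ V k w)) (stdSimplex ℝ (Fin s)) :=
    continuousOn_finsetSum _ fun k _ =>
      continuousOn_const.mul ((hdot k).log fun w hw => (hpos k w hw).ne')
  obtain ⟨w, hw, hmin⟩ := (isCompact_stdSimplex ℝ (Fin s)).exists_isMinOn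
    ⟨_, single_mem_stdSimplex ℝ (Classical.arbitrary (Fin s))⟩ hF
  refine ⟨w, fun k => V k w, hw, fun k => hV k w hw, fun i => ?_⟩
  set p : ℝ → Fin s → ℝ := fun t => (1 - t) • w + t • Pi.single i 1 with hp
  have hp0 : p 0 = w := by simp [hp]
  have hpmem : Set.MapsTo p (Set.Icc 0 1) (stdSimplex ℝ (Fin s)) := fun t ht =>
    convex_stdSimplex ℝ (Fin s) hw (single_mem_stdSimplex ℝ i) (sub_nonneg.mpr ht.2) ht.1
      (by ring)
  have hGp : ∀ k t, G k (p t) = (1 - t) • G k w + t • N k i := fun k t => by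
    simp only [hG, hp, Pi.add_apply, Pi.smul_apply, smul_eq_mul, add_smul, mul_smul,
      Finset.sum_add_distrib, ← Finset.smul_sum]
    simp [Pi.single_apply, ite_smul]
  have hp_cont : Continuous p := by fun_prop
  have hVp : ∀ k, ContinuousOn (fun t => V k (p t)) (Set.Icc 0 1) := fun k =>
    (hVcont k).comp hp_cont.continuousOn hpmem
  have hΦ : ContinuousOn (fun t => ∑ k, β k *
      ((V k (p t) ⬝ᵥ N k i *ᵥ V k (p t)) / (c k ⬝ᵥ V k (p t)))) (Set.Icc 0 1) :=
    continuousOn_finsetSum _ fun k _ => continuousOn_const.mul <|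
      ((show Continuous fun v : n → ℝ => v ⬝ᵥ N k i *ᵥ v from
        continuous_id.dotProduct (continuous_const.matrix_mulVec continuous_id)).comp_continuousOn
          (hVp k)).div ((hdot k).comp hp_cont.continuousOn hpmem)
        fun t ht => (hpos k _ (hpmem ht)).ne'
  have hle : ∀ t ∈ Set.Ioo (0 : ℝ) 1, ∑ k, β k *
      ((V k (p t) ⬝ᵥ N k i *ᵥ V k (p t)) / (c k ⬝ᵥ V k (p t))) ≤ 1 := fun t ht => by
    have hd : IsDesign (p t) := hpmem ⟨ht.1.le, ht.2.le⟩
    have h1t : 0 < 1 - t := sub_pos.mpr ht.2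
    have hterm : ∀ k, β k * Real.log (c k ⬝ᵥ V k (p t)) - β k * Real.log (c k ⬝ᵥ V k w) ≤
        (β k * t - t * (β k *
          ((V k (p t) ⬝ᵥ N k i *ᵥ V k (p t)) / (c k ⬝ᵥ V k (p t))))) / (1 - t) := fun k => by
      have ha := hpos k w hw
      have hb := hpos k _ hd
      have hCS := sq_dotProduct_mulVec_le (hN k w hw).posSemidef (V k (p t)) (V k w)
      change (V k (p t) ⬝ᵥ G k w *ᵥ V k w) ^ 2 ≤
        (V k (p t) ⬝ᵥ G k w *ᵥ V k (p t)) * (V k w ⬝ᵥ G k w *ᵥ V k w) at hCS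
      have hsplit : c k ⬝ᵥ V k (p t) = (1 - t) * (V k (p t) ⬝ᵥ G k w *ᵥ V k (p t)) +
          t * (V k (p t) ⬝ᵥ N k i *ᵥ V k (p t)) := by
        conv_lhs => rw [dotProduct_comm, ← hV k _ hd]
        rw [hGp, add_mulVec, smul_mulVec, smul_mulVec, dotProduct_add, dotProduct_smul,
          dotProduct_smul, smul_eq_mul, smul_eq_mul]
      rw [hV k w hw, dotProduct_comm _ (c k), dotProduct_comm _ (c k)] at hCS
      set a := c k ⬝ᵥ V k w
      set b := c k ⬝ᵥ V k (p t)
      set g := V k (p t) ⬝ᵥ G k w *ᵥ V k (p t)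
      set q := V k (p t) ⬝ᵥ N k i *ᵥ V k (p t)
      have hba : b / a ≤ g / b := by
        rw [div_le_div_iff₀ ha hb]
        linarith
      have hlog : Real.log (b / a) ≤ g / b - 1 :=
        (Real.log_le_sub_one_of_pos (div_pos hb ha)).trans (by linarith)
      rw [Real.log_div hb.ne' ha.ne'] at hlog
      have hg : g = (b - t * q) / (1 - t) := by
        field_simp
        linarith
      calc β k * Real.log b - β k * Real.log a = β k * (Real.log b - Real.log a) := by ring
        _ ≤ β k * (g / b - 1) := mul_le_mul_of_nonneg_left hlog (hβ k).le
        _ = _ := by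
          rw [hg]
          field_simp
          ring
    have hmin' : 0 ≤ ∑ k, (β k * Real.log (c k ⬝ᵥ V k (p t)) -
        β k * Real.log (c k ⬝ᵥ V k w)) := by
      rw [Finset.sum_sub_distrib, sub_nonneg]
      exact hmin hd
    have h := hmin'.trans (Finset.sum_le_sum fun k _ => hterm k)
    rw [← Finset.sum_div, Finset.sum_sub_distrib, ← Finset.sum_mul, hβ1, ← Finset.mul_sum,
      le_div_iff₀ h1t] at h
    nlinarith [ht.1]
  have hlim := ((hΦ 0 ⟨le_rfl, zero_le_one⟩).mono Set.Ioo_subset_Icc_self).tendsto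
  have := left_nhdsWithin_Ioo_neBot (zero_lt_one' ℝ)
  have := le_of_tendsto hlim (eventually_mem_nhdsWithin.mono hle)
  simpa only [hp0] using this

section StrongDuality

variable {s l m r : ℕ} {A : Fin r → Fin s → Matrix (Fin l) (Fin m) ℝ}
  {c : Fin r → Fin m → ℝ} {β : Fin r → ℝ}

/-- Regularizing the information matrices by `δ • 1` produces a dual feasible point, whose value
is attained by a primal solution of the regularized problem. -/
theorem exists_regularized_solution [Nonempty (Fin s)] (hβ : ∀ k, 0 < β k) (hβ1 : ∑ k, β k = 1)
    (hc : ∀ k, c k ≠ 0) {δ : ℝ} (hδ : 0 < δ) :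
    ∃ (τ : Fin r → ℝ) (w : Fin s → ℝ), (∀ k, 0 < τ k) ∧ IsDesign w ∧
      (∀ k, (infoMatK A k w + δ • 1 - τ k • vecMulVec (c k) (c k)).PosSemidef) ∧
      ∑ k, -(β k * Real.log (τ k)) ∈ DβSDPVals A c β := by
  have hsum : ∀ k w, IsDesign w →
      ∑ i, w i • ((A k i)ᵀ * A k i + δ • (1 : Matrix (Fin m) (Fin m) ℝ)) =
        infoMatK A k w + δ • 1 := fun k w hw => by
    simp only [smul_add, Finset.sum_add_distrib, ← Finset.sum_smul, hw.2, one_smul, infoMatK]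
  have hpd : ∀ k w, IsDesign w →
      (infoMatK A k w + δ • (1 : Matrix (Fin m) (Fin m) ℝ)).PosDef := fun k w hw =>
    .posSemidef_add (infoMatK_posSemidef A k hw.1) (PosDef.one.smul hδ)
  obtain ⟨w, u, hw, hu, hle⟩ := exists_isDesign_sum_le_one
    (N := fun k i => (A k i)ᵀ * A k i + δ • 1) hβ hβ1 hc
    fun k w hw => by rw [hsum k w hw]; exact hpd k w hw
  have hu' : ∀ k, (infoMatK A k w + δ • (1 : Matrix (Fin m) (Fin m) ℝ)) *ᵥ u k = c k :=
    fun k => by rw [← hsum k w hw]; exact hu k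
  have hpos := fun k => dotProduct_pos_of_mulVec_eq (hpd k w hw).posSemidef (hc k) (hu' k)
  refine ⟨fun k => (c k ⬝ᵥ u k)⁻¹, w, fun k => inv_pos.mpr (hpos k), hw,
    fun k => posSemidef_sub_inv_smul_vecMulVec (hpd k w hw).posSemidef (hc k) (hu' k), ?_⟩
  simp only [Real.log_inv, mul_neg, neg_neg]
  refine sum_log_mem_dβSDPVals hβ hpos fun i => (Finset.sum_le_sum fun k _ => ?_).trans (hle i)
  refine mul_le_mul_of_nonneg_left (div_le_div_of_nonneg_right ?_ (hpos k).le) (hβ k).le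
  rw [add_mulVec, ← mulVec_mulVec, dotProduct_add, smul_mulVec, one_mulVec, dotProduct_smul,
    dotProduct_mulVec (u k) (A k i)ᵀ, vecMul_transpose]
  exact le_add_of_nonneg_right (mul_nonneg hδ.le (dotProduct_self_star_nonneg (u k)))

theorem exists_mem_pβSDPVals_le [Nonempty (Fin s)] (hβ : ∀ k, 0 < β k) (hβ1 : ∑ k, β k = 1)
    (hc : ∀ k, c k ≠ 0) {x : ℝ} (hx : ∀ d ∈ DβSDPVals A c β, d ≤ x) :
    ∃ y ∈ PβSDPVals A c β, y ≤ x := by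
  choose τ w hτ hw hM hD using fun n : ℕ => exists_regularized_solution (A := A) hβ hβ1 hc
    (Nat.one_div_pos_of_nat (α := ℝ) (n := n))
  have hcc : ∀ k, 0 < c k ⬝ᵥ c k := fun k =>
    lt_of_le_of_ne (dotProduct_self_star_nonneg (c k)) fun h =>
      hc k (dotProduct_self_eq_zero.mp h.symm)
  have hMc : ∀ k, Continuous (infoMatK A k) := fun k => by unfold infoMatK; fun_prop
  have hqc : ∀ k (z : Fin m → ℝ), Continuous fun v => z ⬝ᵥ infoMatK A k v *ᵥ z := fun k z =>
    continuous_const.dotProduct ((hMc k).matrix_mulVec continuous_const)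
  have hquad : ∀ n k z, τ n k * (c k ⬝ᵥ z) ^ 2 ≤
      z ⬝ᵥ infoMatK A k (w n) *ᵥ z + 1 / ((n : ℝ) + 1) * (z ⬝ᵥ z) := fun n k z => by
    have h := (hM n k).dotProduct_mulVec_nonneg z
    rw [star_trivial, dotProduct_sub_smul_vecMulVec_mulVec, add_mulVec, dotProduct_add,
      smul_mulVec, one_mulVec, dotProduct_smul, smul_eq_mul] at h
    linarith
  choose B hB using fun k => ((isCompact_stdSimplex ℝ (Fin s)).bddAbove_image
    (hqc k (c k)).continuousOn)
  have hτB : ∀ n k, τ n k ≤ (B k + c k ⬝ᵥ c k) / (c k ⬝ᵥ c k) ^ 2 := fun n k => by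
    rw [le_div_iff₀ (pow_pos (hcc k) 2)]
    refine (hquad n k (c k)).trans (add_le_add (hB k ⟨w n, hw n, rfl⟩) ?_)
    refine mul_le_of_le_one_left (hcc k).le ?_
    rw [div_le_one (by positivity)]
    exact le_add_of_nonneg_left n.cast_nonneg
  obtain ⟨⟨τ₀, w₀⟩, ⟨hτ₀, hw₀⟩, φ, hφ, hlim⟩ :=
    ((isCompact_univ_pi fun k : Fin r => isCompact_Icc (a := (0 : ℝ))
      (b := (B k + c k ⬝ᵥ c k) / (c k ⬝ᵥ c k) ^ 2)).prod
        (isCompact_stdSimplex ℝ (Fin s))).tendsto_subseq (x := fun n => (τ n, w n))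
      fun n => ⟨fun k _ => ⟨(hτ n k).le, hτB n k⟩, hw n⟩
  have hlimτ : ∀ k, Filter.Tendsto (fun n => τ (φ n) k) Filter.atTop (nhds (τ₀ k)) :=
    fun k => ((continuous_apply k).comp continuous_fst).continuousAt.tendsto.comp hlim
  have hlimw : Filter.Tendsto (fun n => w (φ n)) Filter.atTop (nhds w₀) :=
    continuous_snd.continuousAt.tendsto.comp hlim
  have hprod : ∀ {σ : Fin r → ℝ}, (∀ k, 0 < σ k) →
      ∏ k, σ k ^ β k = Real.exp (-∑ k, -(β k * Real.log (σ k))) := fun {σ} hσ => by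
    rw [← Finset.sum_neg_distrib, Real.exp_sum]
    exact Finset.prod_congr rfl fun k _ => by rw [Real.rpow_def_of_pos (hσ k), neg_neg, mul_comm]
  have hexp : Real.exp (-x) ≤ ∏ k, τ₀ k ^ β k := by
    refine ge_of_tendsto (tendsto_finsetProd _ fun k _ =>
      (hlimτ k).rpow_const (Or.inr (hβ k).le)) (.of_forall fun n => ?_)
    rw [hprod (hτ (φ n)), Real.exp_le_exp, neg_le_neg_iff]
    exact hx _ (hD (φ n))
  have hτ₀pos : ∀ k, 0 < τ₀ k := fun k =>
    lt_of_le_of_ne (hτ₀ k (Set.mem_univ k)).1 fun h => by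
      rw [Finset.prod_eq_zero (Finset.mem_univ k)
        (by rw [← h, Real.zero_rpow (hβ k).ne'])] at hexp
      exact (Real.exp_pos _).not_ge hexp
  refine ⟨_, ⟨τ₀, w₀, hτ₀pos, hw₀, fun k => .of_dotProduct_mulVec_nonneg
    (isHermitian_sub_smul_vecMulVec (infoMatK_posSemidef A k hw₀.1).isHermitian _ _)
    fun z => ?_, rfl⟩, ?_⟩
  · rw [star_trivial, dotProduct_sub_smul_vecMulVec_mulVec, sub_nonneg]
    have hδ := (tendsto_one_div_add_atTop_nhds_zero_nat (𝕜 := ℝ)).comp hφ.tendsto_atTop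
    have hrhs := (((hqc k z).tendsto w₀).comp hlimw).add (hδ.mul_const (z ⬝ᵥ z))
    rw [zero_mul, add_zero] at hrhs
    exact le_of_tendsto_of_tendsto' ((hlimτ k).mul_const _) hrhs fun n => hquad (φ n) k z
  · rw [hprod hτ₀pos, Real.exp_le_exp, neg_le_neg_iff] at hexp
    exact hexp

theorem pβSDPVals_nonempty [Nonempty (Fin s)] (hc : ∀ k, c k ≠ 0)
    (hrange : ∀ k, ∃ u, (∑ i, (A k i)ᵀ * A k i) *ᵥ u = c k) : (PβSDPVals A c β).Nonempty := by
  have hs : (0 : ℝ) < s := Nat.cast_pos.mpr (Fin.pos_iff_nonempty.mpr inferInstance)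
  choose u hu using hrange
  refine ⟨_, sVal_subset_pβSDPVals (w := fun _ => (s : ℝ)⁻¹) hc
    ⟨fun _ => (inv_pos.mpr hs).le, by simp [hs.ne']⟩ ⟨fun k => (s : ℝ) • u k, fun k => ?_, rfl⟩⟩
  rw [infoMatK, ← Finset.smul_sum, mulVec_smul, smul_mulVec, hu, smul_smul,
    mul_inv_cancel₀ hs.ne', one_smul]

/-- Strong duality, with attainment of the primal infimum. -/
theorem exists_isLeast_pβSDPVals_isLUB_dβSDPVals [Nonempty (Fin s)] (hβ : ∀ k, 0 < β k)
    (hβ1 : ∑ k, β k = 1) (hc : ∀ k, c k ≠ 0)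
    (hrange : ∀ k, ∃ u, (∑ i, (A k i)ᵀ * A k i) *ᵥ u = c k) :
    ∃ y, IsLeast (PβSDPVals A c β) y ∧ IsLUB (DβSDPVals A c β) y ∧
      (DβSDPVals A c β).Nonempty := by
  obtain ⟨τ, w, -, -, -, hD⟩ := exists_regularized_solution (A := A) hβ hβ1 hc one_pos
  obtain ⟨y₀, hy₀⟩ := pβSDPVals_nonempty (β := β) hc hrange
  have hbdd : BddAbove (DβSDPVals A c β) :=
    ⟨y₀, fun x hx => dβSDPVals_le_pβSDPVals hβ hβ1 hx hy₀⟩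
  have hlub := isLUB_csSup ⟨_, hD⟩ hbdd
  obtain ⟨y, hy, hle⟩ := exists_mem_pβSDPVals_le hβ hβ1 hc hlub.1
  have hge : ∀ z ∈ PβSDPVals A c β, sSup (DβSDPVals A c β) ≤ z := fun z hz =>
    hlub.2 fun x hx => dβSDPVals_le_pβSDPVals hβ hβ1 hx hz
  obtain rfl := le_antisymm hle (hge y hy)
  exact ⟨_, ⟨hy, hge⟩, hlub, _, hD⟩

end StrongDuality

/-- **The `S_β`-optimal design SDP and its dual.** The minimum of `S_β` over feasible
designs equals the infimum of `(P_β-SDP)` and the supremum of `(D_β-SDP)`; moreover any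
`(τ, w)` attaining the infimum in `(P_β-SDP)` has `w` minimizing `S_β` over feasible
designs. -/
theorem sOptimal_SDP {s l m r : ℕ}
    (A : Fin r → Fin s → Matrix (Fin l) (Fin m) ℝ)
    (c : Fin r → Fin m → ℝ) (β : Fin r → ℝ)
    (hβ : ∀ k, 0 < β k) (hβ1 : ∑ k, β k = 1)
    (hc : ∀ k, c k ≠ 0)
    (hrange : ∀ k, ∃ u, (∑ i, (A k i)ᵀ * A k i) *ᵥ u = c k) :
    (∃ (w₀ : Fin s → ℝ) (v₀ : ℝ), IsDesign w₀ ∧ FeasibleS A c w₀ ∧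
      v₀ ∈ SVal A c β w₀ ∧
      (∀ (w : Fin s → ℝ) (v : ℝ), IsDesign w → FeasibleS A c w →
        v ∈ SVal A c β w → v₀ ≤ v) ∧
      v₀ = sInf (PβSDPVals A c β) ∧
      v₀ = sSup (DβSDPVals A c β)) ∧
    (∀ (τ : Fin r → ℝ) (w : Fin s → ℝ),
      (∀ k, 0 < τ k) → IsDesign w →
      (∀ k, (infoMatK A k w - τ k • Matrix.vecMulVec (c k) (c k)).PosSemidef) →
      (∑ k, -(β k * Real.log (τ k))) = sInf (PβSDPVals A c β) →
      FeasibleS A c w ∧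
        (∀ (x : ℝ), x ∈ SVal A c β w →
          ∀ (w' : Fin s → ℝ) (x' : ℝ), IsDesign w' → FeasibleS A c w' →
            x' ∈ SVal A c β w' → x ≤ x')) := by
  have hr : Nonempty (Fin r) := by
    by_contra h
    rw [not_nonempty_iff] at h
    simp at hβ1
  have hs : Nonempty (Fin s) := by
    by_contra h
    rw [not_nonempty_iff] at h
    obtain ⟨k⟩ := hr
    obtain ⟨u, hu⟩ := hrange k
    exact hc k (by simpa using hu.symm)
  obtain ⟨y, hleast, hlub, hne⟩ :=
    exists_isLeast_pβSDPVals_isLUB_dβSDPVals (β := β) hβ hβ1 hc hrange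
  have hinf : sInf (PβSDPVals A c β) = y := hleast.csInf_eq
  have hS : ∀ (w : Fin s → ℝ) (v : ℝ), IsDesign w → v ∈ SVal A c β w → y ≤ v :=
    fun w v hw hv => hleast.2 (sVal_subset_pβSDPVals hc hw hv)
  constructor
  · obtain ⟨τ, w, hτ, hw, hM, hy⟩ := hleast.1
    have hfeas := feasibleS_of_posSemidef_sub hτ hw hM
    choose u hu using hfeas
    have hmem : ∑ k, β k * Real.log (c k ⬝ᵥ u k) ∈ SVal A c β w := ⟨u, hu, rfl⟩
    have heq : y = ∑ k, β k * Real.log (c k ⬝ᵥ u k) :=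
      le_antisymm (hS w _ hw hmem) (hy ▸ le_of_mem_sVal hβ hc hτ hw hM hmem)
    exact ⟨w, y, hw, fun k => ⟨u k, hu k⟩, heq ▸ hmem, fun w' v hw' _ hv => hS w' v hw' hv,
      hinf.symm, (hlub.csSup_eq hne).symm⟩
  · intro τ w hτ hw hM hval
    refine ⟨feasibleS_of_posSemidef_sub hτ hw hM, fun x hx w' x' hw' _ hx' => ?_⟩
    exact ((le_of_mem_sVal hβ hc hτ hw hM hx).trans_eq (hval.trans hinf)).trans (hS w' x' hw' hx')
end
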